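/- arXiv:2207.11973 — 10 statements merged into one kernel-verified Lean document; each statement's English description precedes it below -/
import Mathlib

section
/- Let γ be a path in ℝ² joining two points a and b. If γ is xy-monotone, then the image of γ is orthogonally convex. -/
/-- A set `S ⊆ ℝⁿ` is orthogonally convex if its intersection with every
axis-aligned line is connected (possibly empty, i.e. preconnected). -/
def OrthoConvex {n : ℕ} (S : Set (EuclideanSpace ℝ (Fin n))) : Prop :=
  ∀ (i : Fin n) (c : EuclideanSpace ℝ (Fin n)),
    IsPreconnected {p ∈ S | ∀ j, j ≠ i → p j = c j}

/-- A set of points in the plane is `xy`-monotone if either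
`(u_x - v_x)(u_y - v_y) ≤ 0` for all pairs of its points, or
`(u_x - v_x)(u_y - v_y) ≥ 0` for all pairs of its points. -/
def XYMonotone (s : Set (EuclideanSpace ℝ (Fin 2))) : Prop :=
  (∀ u ∈ s, ∀ v ∈ s, (u 0 - v 0) * (u 1 - v 1) ≤ 0) ∨
  (∀ u ∈ s, ∀ v ∈ s, 0 ≤ (u 0 - v 0) * (u 1 - v 1))

theorem aux_convex (S : Set (EuclideanSpace ℝ (Fin 2))) (hS : IsPreconnected S) (s : ℝ)
    (hs : s * s = 1)
    (h : ∀ u ∈ S, ∀ v ∈ S, 0 ≤ (u 0 - v 0) * (s * (u 1 - v 1))) : OrthoConvex S := by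
  intro i c
  apply Convex.isPreconnected
  rintro p ⟨hp, hpc⟩ q ⟨hq, hqc⟩ α β hα hβ hαβ
  have hf : Continuous (fun p : EuclideanSpace ℝ (Fin 2) => p 0 + s * p 1) := by fun_prop
  have hc : Convex ℝ ((fun p : EuclideanSpace ℝ (Fin 2) => p 0 + s * p 1) '' S) :=
    (hS.image _ hf.continuousOn).ordConnected.convex
  obtain ⟨r, hr, hre⟩ := hc (Set.mem_image_of_mem _ hp) (Set.mem_image_of_mem _ hq) hα hβ hαβ
  simp only [smul_eq_mul] at hre
  have h1 := mul_nonneg hα (h r hr p hp)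
  have h2 := mul_nonneg hβ (h r hr q hq)
  have hβ' : β = 1 - α := by linarith
  subst hβ'
  have key : r = α • p + (1 - α) • q := by
    fin_cases i
    · have e1 := hpc 1 (by simp)
      have e2 := hqc 1 (by simp)
      rw [e1, e2] at hre
      rw [e1] at h1
      rw [e2] at h2
      have h0 : r 0 = α * p 0 + (1 - α) * q 0 - s * (r 1 - c 1) := by linarith
      rw [h0] at h1 h2
      have hd : (s * (r 1 - c 1)) ^ 2 ≤ 0 := by nlinarith
      have hd0 : s * (r 1 - c 1) = 0 := by
        exact pow_eq_zero_iff (two_ne_zero) |>.1 (le_antisymm hd (sq_nonneg _))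
      have hr1 : r 1 = c 1 := by linear_combination s * hd0 - (r 1 - c 1) * hs
      ext j
      fin_cases j
      · simp; linarith
      · simp [e1, e2, hr1]; ring
    · have e1 := hpc 0 (by simp)
      have e2 := hqc 0 (by simp)
      rw [e1, e2] at hre
      rw [e1] at h1
      rw [e2] at h2
      have h0 : s * r 1 = α * (s * p 1) + (1 - α) * (s * q 1) - (r 0 - c 0) := by linarith
      have hd : (r 0 - c 0) ^ 2 ≤ 0 := by
        rw [mul_sub s, h0] at h1 h2
        nlinarith
      have hd0 : r 0 - c 0 = 0 := by
        exact pow_eq_zero_iff (two_ne_zero) |>.1 (le_antisymm hd (sq_nonneg _))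
      ext j
      fin_cases j
      · simp [e1, e2]; linarith
      · simp
        linear_combination s * h0 - s * hd0 - (r 1 - α * p 1 - (1 - α) * q 1) * hs
  refine ⟨key ▸ hr, fun j hj => ?_⟩
  simp [hpc j hj, hqc j hj]
  ring

/-- If a path `γ` joining `a` and `b` in `ℝ²` is `xy`-monotone, then its image
is orthogonally convex. -/
theorem xyMonotone_path_orthoConvex (a b : EuclideanSpace ℝ (Fin 2)) (γ : Path a b)
    (h : XYMonotone (Set.range γ)) : OrthoConvex (Set.range γ) := by
  have hS : IsPreconnected (Set.range γ) := isPreconnected_range γ.continuous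
  rcases h with h | h
  · refine aux_convex _ hS (-1) (by norm_num) fun u hu v hv => ?_
    have := h u hu v hv
    linarith
  · refine aux_convex _ hS 1 (by norm_num) fun u hu v hv => ?_
    have := h u hu v hv
    linarith
end

section
/- Let S be a closed, path-connected, and orthogonally convex set in ℝ², and let a, b ∈ S. Then there exists a path joining a and b whose image is contained in S and is orthogonally convex (such a path is called an ortho-convex path). -/
theorem oc_between (S : Set (ℝ × ℝ)) (hc : IsPreconnected S)
    (hh : ∀ x₁ x x₂ y, (x₁, y) ∈ S → (x₂, y) ∈ S → x₁ ≤ x → x ≤ x₂ → (x, y) ∈ S)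
    (hv : ∀ x y₁ y y₂, (x, y₁) ∈ S → (x, y₂) ∈ S → y₁ ≤ y → y ≤ y₂ → (x, y) ∈ S)
    (p q : ℝ × ℝ) (hp : p ∈ S) (hq : q ∈ S) (hpq : p ≤ q) (hne : p ≠ q) :
    ∃ r ∈ S, p ≤ r ∧ r ≤ q ∧ r ≠ p ∧ r ≠ q := by
  obtain ⟨px, py⟩ := p
  obtain ⟨qx, qy⟩ := q
  obtain ⟨h1, h2⟩ := Prod.mk_le_mk.1 hpq
  rcases h1.eq_or_lt with h1 | h1
  · subst h1
    have h2' : py < qy := lt_of_le_of_ne h2 (fun h => hne (by rw [h]))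
    refine ⟨(px, (py + qy) / 2), hv _ _ _ _ hp hq (by linarith) (by linarith), ?_, ?_, ?_, ?_⟩
    · exact Prod.mk_le_mk.2 ⟨le_rfl, by linarith⟩
    · exact Prod.mk_le_mk.2 ⟨le_rfl, by linarith⟩
    · intro h; have := congrArg Prod.snd h; simp at this; linarith
    · intro h; have := congrArg Prod.snd h; simp at this; linarith
  rcases h2.eq_or_lt with h2 | h2
  · subst h2
    refine ⟨((px + qx) / 2, py), hh _ _ _ _ hp hq (by linarith) (by linarith), ?_, ?_, ?_, ?_⟩
    · exact Prod.mk_le_mk.2 ⟨by linarith, le_rfl⟩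
    · exact Prod.mk_le_mk.2 ⟨by linarith, le_rfl⟩
    · intro h; have := congrArg Prod.fst h; simp at this; linarith
    · intro h; have := congrArg Prod.fst h; simp at this; linarith
  by_contra hcon
  have hA : (px, qy) ∉ S := fun h => hcon ⟨_, h, Prod.mk_le_mk.2 ⟨le_rfl, h2.le⟩,
    Prod.mk_le_mk.2 ⟨h1.le, le_rfl⟩, by simp [h2.ne'], by simp [h1.ne]⟩
  have hB : (qx, py) ∉ S := fun h => hcon ⟨_, h, Prod.mk_le_mk.2 ⟨h1.le, le_rfl⟩,
    Prod.mk_le_mk.2 ⟨le_rfl, h2.le⟩, by simp [h1.ne'], by simp [h2.ne]⟩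
  have lo1 : ∀ c : ℝ, IsOpen {r : ℝ × ℝ | c < r.1} := fun c =>
    isOpen_lt continuous_const continuous_fst
  have lo2 : ∀ c : ℝ, IsOpen {r : ℝ × ℝ | c < r.2} := fun c =>
    isOpen_lt continuous_const continuous_snd
  have up1 : ∀ c : ℝ, IsOpen {r : ℝ × ℝ | r.1 < c} := fun c =>
    isOpen_lt continuous_fst continuous_const
  have up2 : ∀ c : ℝ, IsOpen {r : ℝ × ℝ | r.2 < c} := fun c =>
    isOpen_lt continuous_snd continuous_const
  have oU := (lo1 px).inter (lo2 py)
  have oV := (up1 px).union ((up2 py).union ((up1 qx).inter (up2 qy)))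
  obtain ⟨r, hrS, hrU, hrV⟩ := hc _ _ oU oV (by
    rintro ⟨x, y⟩ hr
    by_contra hn
    simp only [Set.mem_union, Set.mem_inter_iff, Set.mem_ofPred_eq, not_or, not_lt, not_and] at hn
    obtain ⟨hU, hx, hy, hV⟩ := hn
    rcases hx.eq_or_lt with hx | hx
    · subst hx
      exact hA (hv _ _ _ _ hp hr h2.le (hV h1))
    · have : y = py := le_antisymm (hU hx) hy
      subst this
      have : qx ≤ x := by
        by_contra h
        have := hV (not_le.1 h)
        linarith
      exact hB (hh _ _ _ _ hp hr h1.le this)) ⟨_, hq, h1, h2⟩ ⟨_, hp, Or.inr (Or.inr ⟨h1, h2⟩)⟩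
  obtain ⟨x, y⟩ := r
  simp only [Set.mem_union, Set.mem_inter_iff, Set.mem_ofPred_eq] at hrU hrV
  obtain ⟨u1, u2⟩ := hrU
  rcases hrV with h | h | ⟨h, h'⟩
  · linarith
  · linarith
  · exact hcon ⟨_, hrS, Prod.mk_le_mk.2 ⟨u1.le, u2.le⟩, Prod.mk_le_mk.2 ⟨h.le, h'.le⟩,
      by simp [u1.ne'], by simp [h.ne]⟩

theorem oc_core (S : Set (ℝ × ℝ)) (hcl : IsClosed S) (hc : IsPreconnected S)
    (hh : ∀ x₁ x x₂ y, (x₁, y) ∈ S → (x₂, y) ∈ S → x₁ ≤ x → x ≤ x₂ → (x, y) ∈ S)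
    (hv : ∀ x y₁ y y₂, (x, y₁) ∈ S → (x, y₂) ∈ S → y₁ ≤ y → y ≤ y₂ → (x, y) ∈ S)
    (a b : ℝ × ℝ) (ha : a ∈ S) (hb : b ∈ S) (hab : a ≤ b) :
    ∃ f : ℝ → ℝ × ℝ, Continuous f ∧ Monotone f ∧ f 0 = a ∧ f 1 = b ∧ ∀ t, f t ∈ S := by
  classical
  let K : Set (ℝ × ℝ) := S ∩ Set.Icc a b
  have hK : IsCompact K := isCompact_Icc.inter_left hcl
  obtain ⟨C, hCK, hchain, hmax⟩ : ∃ C ⊆ K, (∀ z ∈ C, ∀ w ∈ C, z ≤ w ∨ w ≤ z) ∧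
      ∀ z ∈ K, (∀ w ∈ C, z ≤ w ∨ w ≤ z) → z ∈ C := by
    let r : K → K → Prop := fun x y => x.1 ≤ y.1
    have hM := maxChain_spec (r := r)
    refine ⟨Subtype.val '' maxChain r, ?_, ?_, ?_⟩
    · rintro _ ⟨z, _, rfl⟩; exact z.2
    · rintro _ ⟨z, hz, rfl⟩ _ ⟨w, hw, rfl⟩
      by_cases h : z = w
      · left; rw [h]
      · exact hM.1 hz hw h
    · intro z hz hw
      have hi : IsChain r (insert ⟨z, hz⟩ (maxChain r)) :=
        hM.1.insert (fun w hwC _ => hw _ ⟨w, hwC, rfl⟩)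
      have := hM.2 hi (Set.subset_insert _ _)
      exact ⟨⟨z, hz⟩, this ▸ Set.mem_insert _ _, rfl⟩
  have haC : a ∈ C := hmax a ⟨ha, le_rfl, hab⟩ (fun w hw => Or.inl (hCK hw).2.1)
  have hbC : b ∈ C := hmax b ⟨hb, hab, le_rfl⟩ (fun w hw => Or.inr (hCK hw).2.2)
  have hCcl : IsClosed C := by
    refine isClosed_of_closure_subset fun z hz => hmax z ?_ ?_
    · exact closure_minimal hCK hK.isClosed hz
    · intro w hw
      have hcw : IsClosed {z : ℝ × ℝ | z ≤ w ∨ w ≤ z} :=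
        (isClosed_le continuous_id continuous_const).union
          (isClosed_le continuous_const continuous_id)
      exact closure_minimal (fun z hz => hchain z hz w hw) hcw hz
  have hCc : IsCompact C := hK.of_isClosed_subset hCcl hCK
  let s : ℝ × ℝ → ℝ := fun z => z.1 + z.2
  have hs : Continuous s := by fun_prop
  have smono : ∀ z w : ℝ × ℝ, z ≤ w → s z ≤ s w := fun z w h => add_le_add h.1 h.2
  have seq : ∀ z w : ℝ × ℝ, z ≤ w → s w ≤ s z → z = w := by
    intro z w h h'
    have h1 := h.1
    have h2 := h.2
    simp only [s] at h'
    exact Prod.ext (by linarith) (by linarith)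
  have sle : ∀ z ∈ C, ∀ w ∈ C, s z ≤ s w → z ≤ w := by
    intro z hz w hw h
    rcases hchain z hz w hw with h' | h'
    · exact h'
    · exact (seq w z h' h).ge
  have surj : ∀ t, s a ≤ t → t ≤ s b → ∃ z ∈ C, s z = t := by
    intro t h1 h2
    obtain ⟨p, ⟨hpC, hpt⟩, hpm⟩ := (hCc.inter_right
      (isClosed_le hs (continuous_const (y := t)))).exists_isMaxOn ⟨a, haC, h1⟩ hs.continuousOn
    obtain ⟨q, ⟨hqC, hqt⟩, hqm⟩ := (hCc.inter_right
      (isClosed_le (continuous_const (y := t)) hs)).exists_isMinOn ⟨b, hbC, h2⟩ hs.continuousOn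
    simp only [Set.mem_ofPred_eq] at hpt hqt
    by_contra hcon
    have hpt' : s p < t := lt_of_le_of_ne hpt fun h => hcon ⟨p, hpC, h⟩
    have hqt' : t < s q := lt_of_le_of_ne hqt fun h => hcon ⟨q, hqC, h.symm⟩
    have hpq : p ≤ q := sle p hpC q hqC (by linarith)
    obtain ⟨r, hrS, hpr, hrq, hrp, hrq'⟩ := oc_between S hc hh hv p q (hCK hpC).1 (hCK hqC).1 hpq
      (by rintro rfl; linarith)
    have hrC : r ∈ C := by
      refine hmax r ⟨hrS, (hCK hpC).2.1.trans hpr, hrq.trans (hCK hqC).2.2⟩ ?_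
      intro w hw
      rcases le_total (s w) t with h | h
      · exact Or.inr ((sle w hw p hpC (hpm ⟨hw, h⟩)).trans hpr)
      · exact Or.inl (hrq.trans (sle q hqC w hw (hqm ⟨hw, h⟩)))
    rcases le_total (s r) t with h | h
    · exact hrp (seq p r hpr (hpm ⟨hrC, h⟩)).symm
    · exact hrq' (seq r q hrq (hqm ⟨hrC, h⟩))
  have hsab := smono a b hab
  let τ : ℝ → ℝ := fun u => max (s a) (min (s b) (s a + u * (s b - s a)))
  have hτc : Continuous τ := by fun_prop
  have hτm : Monotone τ := by
    intro u v h
    have : u * (s b - s a) ≤ v * (s b - s a) := mul_le_mul_of_nonneg_right h (by linarith)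
    exact max_le_max le_rfl (min_le_min le_rfl (by linarith))
  choose f hfC hfs using fun u => surj (τ u) (le_max_left _ _) (max_le hsab (min_le_left _ _))
  have hfm : Monotone f := fun u v h => sle _ (hfC u) _ (hfC v) (by
    rw [hfs, hfs]; exact hτm h)
  have key : ∀ u v, u ≤ v → dist (f u) (f v) ≤ dist (τ u) (τ v) := by
    intro u v h
    have h1 := (hfm h).1
    have h2 := (hfm h).2
    rw [← hfs u, ← hfs v, Prod.dist_eq, Real.dist_eq, Real.dist_eq, Real.dist_eq]
    simp only [s]
    rw [abs_of_nonpos (by linarith), abs_of_nonpos (by linarith), abs_of_nonpos (by linarith)]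
    exact max_le (by linarith) (by linarith)
  have key' : ∀ u v, dist (f u) (f v) ≤ dist (τ u) (τ v) := by
    intro u v
    rcases le_total u v with h | h
    · exact key u v h
    · rw [dist_comm, dist_comm (τ u)]; exact key v u h
  have uniq : ∀ z ∈ C, ∀ w ∈ C, s z = s w → z = w := fun z hz w hw h =>
    le_antisymm (sle z hz w hw h.le) (sle w hw z hz h.ge)
  refine ⟨f, ?_, hfm, ?_, ?_, fun t => (hCK (hfC t)).1⟩
  · rw [Metric.continuous_iff] at hτc ⊢
    intro v ε hε
    obtain ⟨δ, hδ, h⟩ := hτc v ε hε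
    exact ⟨δ, hδ, fun u hu => (key' u v).trans_lt (h u hu)⟩
  · refine uniq _ (hfC 0) _ haC ?_
    rw [hfs]
    simp [τ, hsab]
  · refine uniq _ (hfC 1) _ hbC ?_
    rw [hfs]
    simp [τ, hsab]

theorem oc_range {a b : EuclideanSpace ℝ (Fin 2)} (γ : Path a b)
    (h : ∀ j, Monotone (fun t => γ t j) ∨ Antitone (fun t => γ t j)) :
    OrthoConvex (Set.range γ) := by
  intro i c
  have e : {p ∈ Set.range γ | ∀ j, j ≠ i → p j = c j} =
      γ '' {t | ∀ j, j ≠ i → γ t j = c j} := by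
    ext p
    constructor
    · rintro ⟨⟨t, rfl⟩, h⟩; exact ⟨t, h, rfl⟩
    · rintro ⟨t, h, rfl⟩; exact ⟨⟨t, rfl⟩, h⟩
  rw [e]
  refine IsPreconnected.image ?_ _ γ.continuous.continuousOn
  refine Set.OrdConnected.isPreconnected ⟨fun u hu v hv t ht j hj => ?_⟩
  have h1 := hu j hj
  have h2 := hv j hj
  rcases h j with hm | hm
  · have h3 := hm ht.1
    have h4 := hm ht.2
    simp only at h3 h4
    linarith
  · have h3 := hm ht.1
    have h4 := hm ht.2
    simp only at h3 h4
    linarith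

theorem oc_conv (A : Set (EuclideanSpace ℝ (Fin 2))) (i : Fin 2) (hA : IsPreconnected A)
    (p q : EuclideanSpace ℝ (Fin 2)) (hp : p ∈ A) (hq : q ∈ A) (x : ℝ)
    (h1 : p i ≤ x) (h2 : x ≤ q i) : ∃ r ∈ A, r i = x := by
  have hcont : ContinuousOn (fun r : EuclideanSpace ℝ (Fin 2) => r i) A := by fun_prop
  exact hA.intermediate_value hp hq hcont ⟨h1, h2⟩

theorem oc_aux (S : Set (EuclideanSpace ℝ (Fin 2)))
    (hcl : IsClosed S) (hpc : IsPathConnected S) (hoc : OrthoConvex S)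
    (a b : EuclideanSpace ℝ (Fin 2)) (ha : a ∈ S) (hb : b ∈ S) (hab : a 0 ≤ b 0) :
    ∃ γ : Path a b, Set.range γ ⊆ S ∧ OrthoConvex (Set.range γ) := by
  obtain ⟨σ, hσ, hσab⟩ : ∃ σ : ℝ, (σ = 1 ∨ σ = -1) ∧ σ * a 1 ≤ σ * b 1 := by
    rcases le_total (a 1) (b 1) with h | h
    · exact ⟨1, Or.inl rfl, by linarith⟩
    · exact ⟨-1, Or.inr rfl, by linarith⟩
  have hσσ : ∀ y, σ * (σ * y) = y := by
    intro y; rcases hσ with rfl | rfl <;> ring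
  let φ : ℝ × ℝ → EuclideanSpace ℝ (Fin 2) := fun z => !₂[z.1, σ * z.2]
  let ψ : EuclideanSpace ℝ (Fin 2) → ℝ × ℝ := fun p => (p 0, σ * p 1)
  have hφ0 : ∀ z, φ z 0 = z.1 := fun z => by simp [φ]
  have hφ1 : ∀ z, φ z 1 = σ * z.2 := fun z => by simp [φ]
  have hφc : Continuous φ := by fun_prop
  have hψc : Continuous ψ := by fun_prop
  have hφψ : ∀ p, φ (ψ p) = p := by
    intro p
    ext j
    fin_cases j <;> simp [φ, ψ, hσσ]
  have hψφ : ∀ z, ψ (φ z) = z := by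
    intro z
    simp [φ, ψ, hσσ]
  have himg : φ ⁻¹' S = ψ '' S := by
    ext z
    constructor
    · intro h; exact ⟨_, h, hψφ z⟩
    · rintro ⟨p, hp, rfl⟩; simpa [hφψ] using hp
  have conn : IsPreconnected (φ ⁻¹' S) := by
    rw [himg]
    exact hpc.isConnected.isPreconnected.image _ hψc.continuousOn
  obtain ⟨f, hfc, hfm, hf0, hf1, hfS⟩ := oc_core (φ ⁻¹' S) (hcl.preimage hφc) conn (by
      intro x₁ x x₂ y h1 h2 hx1 hx2
      obtain ⟨r, ⟨hrS, hr⟩, hrx⟩ := oc_conv _ 0 (hoc 0 (φ (x, y))) (φ (x₁, y)) (φ (x₂, y))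
        ⟨h1, fun j hj => by fin_cases j <;> simp_all⟩ ⟨h2, fun j hj => by fin_cases j <;> simp_all⟩
        x (by rw [hφ0]; exact hx1) (by rw [hφ0]; exact hx2)
      have : r = φ (x, y) := by
        ext j
        fin_cases j
        · simpa [hφ0] using hrx
        · exact hr 1 (by simp)
      exact Set.mem_preimage.2 (this ▸ hrS)) (by
      intro x y₁ y y₂ h1 h2 hy1 hy2
      have : ∃ r ∈ {p ∈ S | ∀ j, j ≠ 1 → p j = φ (x, y) j}, r 1 = σ * y := by
        rcases hσ with h | h
        · exact oc_conv _ 1 (hoc 1 (φ (x, y))) (φ (x, y₁)) (φ (x, y₂))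
            ⟨h1, fun j hj => by fin_cases j <;> simp_all⟩
            ⟨h2, fun j hj => by fin_cases j <;> simp_all⟩
            (σ * y) (by rw [hφ1, h]; simpa using hy1) (by rw [hφ1, h]; simpa using hy2)
        · exact oc_conv _ 1 (hoc 1 (φ (x, y))) (φ (x, y₂)) (φ (x, y₁))
            ⟨h2, fun j hj => by fin_cases j <;> simp_all⟩
            ⟨h1, fun j hj => by fin_cases j <;> simp_all⟩
            (σ * y) (by rw [hφ1, h]; simpa using hy2) (by rw [hφ1, h]; simpa using hy1)
      obtain ⟨r, ⟨hrS, hr⟩, hrx⟩ := this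
      have : r = φ (x, y) := by
        ext j
        fin_cases j
        · exact hr 0 (by simp)
        · simpa [hφ1] using hrx
      exact Set.mem_preimage.2 (this ▸ hrS)) (ψ a) (ψ b) (by simpa [hφψ] using ha) (by simpa [hφψ] using hb)
      (Prod.mk_le_mk.2 ⟨hab, hσab⟩)
  let γ : Path a b :=
    { toFun := fun t => φ (f t)
      continuous_toFun := by fun_prop
      source' := by simp [hf0, hφψ]
      target' := by simp [hf1, hφψ] }
  have hγ : ∀ t, γ t = φ (f t) := fun t => rfl
  refine ⟨γ, ?_, oc_range γ ?_⟩
  · rintro _ ⟨t, rfl⟩; exact hfS t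
  · intro j
    fin_cases j
    · left
      intro u v h
      have := (hfm (show (u : ℝ) ≤ v from h)).1
      simpa [hγ, hφ0] using this
    · rcases hσ with h | h
      · left
        intro u v huv
        have := (hfm (show (u : ℝ) ≤ v from huv)).2
        simpa [hγ, hφ1, h] using this
      · right
        intro u v huv
        have := (hfm (show (u : ℝ) ≤ v from huv)).2
        simpa [hγ, hφ1, h] using this

/-- In a closed, path-connected, and orthogonally convex set `S ⊆ ℝ²`, any two
points `a, b ∈ S` are joined by a path lying in `S` whose image is
orthogonally convex (an ortho-convex path). -/
theorem exists_orthoConvex_path (S : Set (EuclideanSpace ℝ (Fin 2)))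
    (hcl : IsClosed S) (hpc : IsPathConnected S) (hoc : OrthoConvex S)
    (a b : EuclideanSpace ℝ (Fin 2)) (ha : a ∈ S) (hb : b ∈ S) :
    ∃ γ : Path a b, Set.range γ ⊆ S ∧ OrthoConvex (Set.range γ) := by
  rcases le_total (a 0) (b 0) with h | h
  · exact oc_aux S hcl hpc hoc a b ha hb h
  · obtain ⟨γ, h1, h2⟩ := oc_aux S hcl hpc hoc b a hb ha h
    exact ⟨γ.symm, by rwa [Path.symm_range], by rwa [Path.symm_range]⟩
end

section
/- Let [a,b] be an axis-aligned segment in ℝ² (i.e., a and b have the same first coordinate or the same second coordinate), and let c ∈ [a,b]. Suppose {aₙ} and {bₙ} are sequences in ℝ² with aₙ → a, bₙ → b, and for each n let γₙ be an ortho-convex path joining aₙ and bₙ. Then there exist points cₙ in the image of γₙ, n = 1, 2, …, such that cₙ → c as n → ∞. -/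
open Filter

lemma ocp_half {E : Type*} [TopologicalSpace E] {K : Set E} (hK : IsPreconnected K) {f g : E → ℝ}
    (hf : Continuous f) (hg : Continuous g) {p q : E} (hp : p ∈ K) (hq : q ∈ K) {m s : ℝ}
    (h1 : f p ≤ m) (h2 : m ≤ f q) (h3 : g p ≤ s)
    (H : ∀ z ∈ K, f z = m → s < g z) : ∃ z ∈ K, f z ≤ m ∧ g z = s := by
  by_contra! hn
  have hU : IsOpen {z | f z < m ∧ g z < s} :=
    (isOpen_lt hf continuous_const).inter (isOpen_lt hg continuous_const)
  have hV : IsOpen {z | m < f z ∨ s < g z} :=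
    (isOpen_lt continuous_const hf).union (isOpen_lt continuous_const hg)
  have key : ∀ z ∈ K, ¬ (f z < m ∧ g z < s) → (m < f z ∨ s < g z) := by
    intro z hz h
    by_contra! h'
    rcases h'.1.lt_or_eq with h4 | h4
    · rcases h'.2.lt_or_eq with h5 | h5
      · exact h ⟨h4, h5⟩
      · exact hn z hz h'.1 h5
    · exact absurd (H z hz h4) (not_lt.2 h'.2)
  obtain ⟨z, hz, hz1, hz2⟩ := hK _ _ hU hV
    (fun z hz => by
      by_cases h : f z < m ∧ g z < s
      · exact Or.inl h
      · exact Or.inr (key z hz h))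
    ⟨p, hp, by
      by_contra h
      rcases key p hp h with h' | h' <;> linarith⟩
    ⟨q, hq, key q hq (fun h => by linarith [h.1])⟩
  simp only [Set.mem_ofPred_eq] at hz1 hz2
  rcases hz2 with h | h <;> linarith [hz1.1, hz1.2]

lemma ocp_core {E : Type*} [TopologicalSpace E] {K : Set E} (hK : IsPreconnected K) {f g : E → ℝ}
    (hf : Continuous f) (hg : Continuous g) {p q : E} (hp : p ∈ K) (hq : q ∈ K) {m s : ℝ}
    (h1 : f p ≤ m) (h2 : m ≤ f q) (h3 : g p ≤ s) (h4 : g q ≤ s)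
    (hs : IsPreconnected {z ∈ K | g z = s}) : ∃ z ∈ K, f z = m ∧ g z ≤ s := by
  by_contra! H
  obtain ⟨z, hz, hz1, hz2⟩ := ocp_half hK hf hg hp hq h1 h2 h3 H
  obtain ⟨w, hw, hw1, hw2⟩ := ocp_half hK (f := fun x => - f x) (continuous_neg.comp hf) hg hq hp (m := -m) (s := s) (by simpa using h2)
    (by simpa using h1) h4 (fun z hz h => H z hz (by linarith))
  obtain ⟨v, hv, hv1⟩ := hs.intermediate_value (a := z) (b := w) ⟨hz, hz2⟩ ⟨hw, hw2⟩
    hf.continuousOn (show m ∈ Set.Icc (f z) (f w) from ⟨hz1, by linarith⟩)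
  exact absurd (H v hv.1 hv1) (by simp [hv.2])

lemma ocp_main {E : Type*} [TopologicalSpace E] {K : Set E} (hK : IsPreconnected K) {f g : E → ℝ}
    (hf : Continuous f) (hg : Continuous g)
    (hfs : ∀ s, IsPreconnected {z ∈ K | f z = s})
    (hgs : ∀ s, IsPreconnected {z ∈ K | g z = s})
    {p q : E} (hp : p ∈ K) (hq : q ∈ K) {m : ℝ}
    (h1 : f p ≤ m) (h2 : m ≤ f q) :
    ∃ z ∈ K, f z = m ∧ min (g p) (g q) ≤ g z ∧ g z ≤ max (g p) (g q) := by
  obtain ⟨z, hz, hz1, hz2⟩ := ocp_core hK hf hg hp hq h1 h2 (le_max_left (g p) (g q))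
    (le_max_right _ _) (hgs _)
  obtain ⟨w, hw, hw1, hw2⟩ := ocp_core hK hf (g := fun x => - g x) (continuous_neg.comp hg) hp hq h1 h2 (s := -min (g p) (g q))
    (by simp) (by simp) (by simpa only [neg_inj] using hgs _)
  by_cases h : min (g p) (g q) ≤ g z
  · exact ⟨z, hz, hz1, h, hz2⟩
  · obtain ⟨v, hv, hv1⟩ := (hfs m).intermediate_value (a := z) (b := w) ⟨hz, hz1⟩ ⟨hw, hw1⟩
      hg.continuousOn (show min (g p) (g q) ∈ Set.Icc (g z) (g w) from
        ⟨(not_le.1 h).le, by linarith⟩)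
    exact ⟨v, hv.1, hv.2, hv1.ge, hv1.le.trans min_le_max⟩

lemma ocp_slice {S : Set (EuclideanSpace ℝ (Fin 2))} (hS : OrthoConvex S) (k : Fin 2) (r : ℝ) :
    IsPreconnected {z ∈ S | z k = r} := by
  have := hS (1 - k) (WithLp.toLp 2 fun _ => r)
  convert this using 4
  fin_cases k <;> simp [Fin.forall_fin_two]

lemma ocp_aux (i j : Fin 2) (hij : ∀ k, k = i ∨ k = j) (a b c : EuclideanSpace ℝ (Fin 2))
    (hab : a j = b j) (hc : c ∈ segment ℝ a b)
    (aseq bseq : ℕ → EuclideanSpace ℝ (Fin 2))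
    (ha : Tendsto aseq atTop (nhds a)) (hb : Tendsto bseq atTop (nhds b))
    (γ : ∀ n : ℕ, Path (aseq n) (bseq n))
    (hγ : ∀ n : ℕ, OrthoConvex (Set.range (γ n))) :
    ∃ cseq : ℕ → EuclideanSpace ℝ (Fin 2),
      (∀ n : ℕ, cseq n ∈ Set.range (γ n)) ∧ Tendsto cseq atTop (nhds c) := by
  obtain ⟨u, v, hu, hv, huv, rfl⟩ := hc
  have hcont : ∀ k : Fin 2, Continuous fun z : EuclideanSpace ℝ (Fin 2) => z k := by
    intro k; fun_prop
  have key : ∀ n, ∃ z ∈ Set.range (γ n), z i = u * aseq n i + v * bseq n i ∧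
      min (aseq n j) (bseq n j) ≤ z j ∧ z j ≤ max (aseq n j) (bseq n j) := by
    intro n
    have hK : IsPreconnected (Set.range (γ n)) := isPreconnected_range (γ n).continuous
    have hp : aseq n ∈ Set.range (γ n) := ⟨0, (γ n).source⟩
    have hq : bseq n ∈ Set.range (γ n) := ⟨1, (γ n).target⟩
    have hu' : u = 1 - v := by linarith
    rcases le_total (aseq n i) (bseq n i) with h | h
    · exact ocp_main hK (hcont i) (hcont j) (ocp_slice (hγ n) i) (ocp_slice (hγ n) j) hp hq
        (by rw [hu']; nlinarith) (by rw [hu']; nlinarith)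
    · rw [min_comm, max_comm]
      exact ocp_main hK (hcont i) (hcont j) (ocp_slice (hγ n) i) (ocp_slice (hγ n) j) hq hp
        (by rw [hu']; nlinarith) (by rw [hu']; nlinarith)
  choose z hz hzi hz1 hz2 using key
  refine ⟨z, hz, ?_⟩
  have ha' : ∀ k, Tendsto (fun n => aseq n k) atTop (nhds (a k)) := fun k =>
    ((hcont k).tendsto a).comp ha
  have hb' : ∀ k, Tendsto (fun n => bseq n k) atTop (nhds (b k)) := fun k =>
    ((hcont k).tendsto b).comp hb
  have hall : ∀ k, Tendsto (fun n => z n k) atTop (nhds ((u • a + v • b) k)) := by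
    intro k
    rcases hij k with rfl | rfl
    · simp only [hzi]
      simpa using ((ha' k).const_mul u).add ((hb' k).const_mul v)
    · have e : (u • a + v • b) k = a k := by
        simp only [PiLp.add_apply, PiLp.smul_apply, smul_eq_mul, ← hab, ← add_mul, huv, one_mul]
      rw [e]
      refine tendsto_of_tendsto_of_tendsto_of_le_of_le ?_ ?_ hz1 hz2
      · simpa [← hab] using (ha' k).min (hb' k)
      · simpa [← hab] using (ha' k).max (hb' k)
  have := ((PiLp.continuous_toLp 2 (fun _ : Fin 2 => ℝ)).tendsto _).comp (tendsto_pi_nhds.2 hall)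
  exact this

/-- If `[a, b]` is an axis-aligned segment, `c ∈ [a, b]`, `aₙ → a`, `bₙ → b`,
and `γₙ` is an ortho-convex path joining `aₙ` and `bₙ`, then there are points
`cₙ` in the image of `γₙ` with `cₙ → c`. -/
theorem exists_points_tendsto_of_orthoConvex_paths (a b c : EuclideanSpace ℝ (Fin 2))
    (hab : a 0 = b 0 ∨ a 1 = b 1) (hc : c ∈ segment ℝ a b)
    (aseq bseq : ℕ → EuclideanSpace ℝ (Fin 2))
    (ha : Tendsto aseq atTop (nhds a)) (hb : Tendsto bseq atTop (nhds b))
    (γ : ∀ n : ℕ, Path (aseq n) (bseq n))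
    (hγ : ∀ n : ℕ, OrthoConvex (Set.range (γ n))) :
    ∃ cseq : ℕ → EuclideanSpace ℝ (Fin 2),
      (∀ n : ℕ, cseq n ∈ Set.range (γ n)) ∧ Tendsto cseq atTop (nhds c) := by
  rcases hab with h | h
  · exact ocp_aux 1 0 (by decide) a b c h hc aseq bseq ha hb γ hγ
  · exact ocp_aux 0 1 (by decide) a b c h hc aseq bseq ha hb γ hγ
end

section
/- If S is a path-connected and orthogonally convex subset of ℝ², then its closure cl(S) is also path-connected and orthogonally convex. -/
lemma aux_path (C : Set (ℝ × ℝ)) (hC : IsClosed C)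
    (hB : ∀ p ∈ C, ∀ q ∈ C, p ≤ q → p ≠ q → ∃ r ∈ C, p ≤ r ∧ r ≤ q ∧ r ≠ p ∧ r ≠ q)
    (p q : ℝ × ℝ) (hp : p ∈ C) (hq : q ∈ C) (hpq : p ≤ q) : JoinedIn C p q := by
  let A : Set (ℝ × ℝ) := C ∩ Set.Icc p q
  have hAc : IsCompact A := isCompact_Icc.inter_left hC
  haveI : CompactSpace A := isCompact_iff_compactSpace.1 hAc
  let M : Set A := maxChain (· ≤ ·)
  have hM : IsMaxChain (· ≤ ·) M := maxChain_spec
  have hmem : ∀ z : A, (∀ m ∈ M, z ≤ m ∨ m ≤ z) → z ∈ M := by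
    intro z hz
    have h1 : IsChain (· ≤ ·) (insert z M) := hM.1.insert (fun b hb _ => hz b hb)
    have := hM.2 h1 (Set.subset_insert _ _)
    rw [this]; exact Set.mem_insert _ _
  have hcmp : ∀ a ∈ M, ∀ b ∈ M, a ≤ b ∨ b ≤ a := fun a ha b hb => hM.1.total ha hb
  have hclosed : IsClosed M := by
    refine isClosed_of_closure_subset ?_
    intro z hz
    apply hmem
    intro m hm
    have hcl : IsClosed {z : A | z ≤ m ∨ m ≤ z} :=
      (isClosed_le continuous_subtype_val continuous_const).union
        (isClosed_le continuous_const continuous_subtype_val)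
    exact closure_minimal (fun a ha => hcmp a ha m hm) hcl hz
  have hMc : IsCompact M := hclosed.isCompact
  let s : A → ℝ := fun z => z.1.1 + z.1.2
  have hs : Continuous s := by fun_prop
  let P0 : A := ⟨p, hp, le_refl _, hpq⟩
  let Q0 : A := ⟨q, hq, hpq, le_refl _⟩
  have hP0 : P0 ∈ M := hmem _ (fun m _ => Or.inl m.2.2.1)
  have hQ0 : Q0 ∈ M := hmem _ (fun m _ => Or.inr m.2.2.2)
  have hle : ∀ a b : A, a ≤ b → a.1.1 ≤ b.1.1 ∧ a.1.2 ≤ b.1.2 := fun a b h => h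
  have hsle : ∀ a b : A, a ≤ b → s b ≤ s a → a = b := by
    intro a b h h'
    have := hle a b h
    apply Subtype.ext
    apply Prod.ext <;> simp only [s] at h' <;> linarith
  have hsle' : ∀ a ∈ M, ∀ b ∈ M, s a ≤ s b → a ≤ b := by
    intro a ha b hb h
    rcases hcmp a ha b hb with h1 | h1
    · exact h1
    · exact (hsle b a h1 h).ge
  have hsurj : ∀ t ∈ Set.Icc (s P0) (s Q0), ∃ z ∈ M, s z = t := by
    intro t ht
    by_contra hcon
    push Not at hcon
    obtain ⟨P, hP, hPm⟩ := (hMc.inter_right (isClosed_Iic.preimage hs : IsClosed (s ⁻¹' Set.Iic t))).exists_isMaxOn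
      ⟨P0, hP0, ht.1⟩ hs.continuousOn
    obtain ⟨Q, hQ, hQm⟩ := (hMc.inter_right (isClosed_Ici.preimage hs : IsClosed (s ⁻¹' Set.Ici t))).exists_isMinOn
      ⟨Q0, hQ0, ht.2⟩ hs.continuousOn
    have hPt : s P < t := lt_of_le_of_ne hP.2 (hcon P hP.1)
    have hQt : t < s Q := lt_of_le_of_ne hQ.2 (hcon Q hQ.1).symm
    have hPQ : P ≤ Q := hsle' P hP.1 Q hQ.1 (by linarith)
    have hne : P.1 ≠ Q.1 := by
      intro h
      have : P = Q := Subtype.ext h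
      rw [this] at hPt; linarith
    obtain ⟨r, hr, h1, h2, h3, h4⟩ := hB P.1 P.2.1 Q.1 Q.2.1 hPQ hne
    let R : A := ⟨r, hr, P.2.2.1.trans h1, h2.trans Q.2.2.2⟩
    have hlow : ∀ m ∈ M, s m ≤ t → m ≤ P := fun m hm h =>
      hsle' m hm P hP.1 (hPm ⟨hm, h⟩)
    have hhigh : ∀ m ∈ M, t ≤ s m → Q ≤ m := fun m hm h =>
      hsle' Q hQ.1 m hm (hQm ⟨hm, h⟩)
    have hR : R ∈ M := by
      apply hmem
      intro m hm
      rcases le_total (s m) t with h | h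
      · exact Or.inr ((hlow m hm h).trans h1)
      · exact Or.inl (le_trans (show R ≤ Q from h2) (hhigh m hm h))
    rcases le_total (s R) t with h | h
    · exact h3 (le_antisymm (hlow R hR h) h1)
    · exact h4 (le_antisymm h2 (hhigh R hR h))
  have hch : ∀ t, ∃ z : A, t ∈ Set.Icc (s P0) (s Q0) → z ∈ M ∧ s z = t := by
    intro t
    by_cases ht : t ∈ Set.Icc (s P0) (s Q0)
    · obtain ⟨z, hz⟩ := hsurj t ht
      exact ⟨z, fun _ => hz⟩
    · exact ⟨P0, fun h => absurd h ht⟩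
  choose g hg using hch
  have hlip : LipschitzOnWith 1 (fun t => (g t).1) (Set.Icc (s P0) (s Q0)) := by
    apply LipschitzOnWith.of_dist_le_mul
    intro a ha b hb
    obtain ⟨ha1, ha2⟩ := hg a ha
    obtain ⟨hb1, hb2⟩ := hg b hb
    simp only [s] at ha2 hb2
    rw [Prod.dist_eq, Real.dist_eq, Real.dist_eq, Real.dist_eq, NNReal.coe_one, one_mul]
    rcases hcmp _ ha1 _ hb1 with h | h <;> have := hle _ _ h
    · have e : |a - b| = b - a := by rw [abs_of_nonpos (by linarith)]; ring
      rw [e]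
      apply max_le <;> rw [abs_le] <;> constructor <;> linarith
    · have e : |a - b| = a - b := abs_of_nonneg (by linarith)
      rw [e]
      apply max_le <;> rw [abs_le] <;> constructor <;> linarith
  have hs0 : s P0 ≤ s Q0 := add_le_add hpq.1 hpq.2
  have hpath : IsPathConnected (Set.Icc (s P0) (s Q0)) :=
    (convex_Icc _ _).isPathConnected ⟨_, Set.left_mem_Icc.2 hs0⟩
  have him := hpath.image' hlip.continuousOn
  have e1 : (g (s P0)) = P0 := by
    obtain ⟨h1, h2⟩ := hg (s P0) (Set.left_mem_Icc.2 hs0)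
    exact (hsle P0 _ ((g (s P0)).2.2.1) h2.le).symm
  have e2 : (g (s Q0)) = Q0 := by
    obtain ⟨h1, h2⟩ := hg (s Q0) (Set.right_mem_Icc.2 hs0)
    exact (hsle _ Q0 ((g (s Q0)).2.2.2) h2.ge)
  have := him.joinedIn p ⟨s P0, Set.left_mem_Icc.2 hs0, by simp only [e1]; rfl⟩
    q ⟨s Q0, Set.right_mem_Icc.2 hs0, by simp only [e2]; rfl⟩
  apply this.mono
  rintro _ ⟨t, _, rfl⟩
  exact (g t).2.1

lemma aux_A (T : Set (ℝ × ℝ)) (hT : IsPreconnected T)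
    (hH : ∀ a b c y, (a, y) ∈ T → (b, y) ∈ T → a ≤ c → c ≤ b → (c, y) ∈ T)
    (hV : ∀ a b c x, (x, a) ∈ T → (x, b) ∈ T → a ≤ c → c ≤ b → (x, c) ∈ T)
    (x1 y1 x2 y2 c : ℝ) (hp : (x1, y1) ∈ T) (hq : (x2, y2) ∈ T)
    (h1 : x1 < c) (h2 : c < x2) (hy : y1 ≤ y2) : ∃ h, y1 ≤ h ∧ h ≤ y2 ∧ (c, h) ∈ T := by
  rcases hy.eq_or_lt with hy | hy
  · subst hy
    exact ⟨y1, le_refl _, le_refl _, hH _ _ _ _ hp hq h1.le h2.le⟩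
  have k1 : ∃ z ∈ T, z.1 ≤ c ∧ z.2 ≤ y2 ∧ (z.1 = c ∨ z.2 = y2) := by
    by_contra hcon
    push Not at hcon
    have := hT {z | z.1 < c ∧ z.2 < y2} {z | c < z.1 ∨ y2 < z.2}
      ((isOpen_lt continuous_fst continuous_const).inter
        (isOpen_lt continuous_snd continuous_const))
      ((isOpen_lt continuous_const continuous_fst).union
        (isOpen_lt continuous_const continuous_snd))
      (by
        intro z hz
        by_cases h : c < z.1 ∨ y2 < z.2
        · exact Or.inr h
        · push Not at h
          have := hcon z hz h.1 h.2
          exact Or.inl ⟨lt_of_le_of_ne h.1 this.1, lt_of_le_of_ne h.2 this.2⟩)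
      ⟨_, hp, h1, hy⟩ ⟨_, hq, Or.inl h2⟩
    obtain ⟨z, -, ⟨a, b⟩, (d | d)⟩ := this <;> linarith
  have k2 : ∃ z ∈ T, c ≤ z.1 ∧ y1 ≤ z.2 ∧ (z.1 = c ∨ z.2 = y1) := by
    by_contra hcon
    push Not at hcon
    have := hT {z | c < z.1 ∧ y1 < z.2} {z | z.1 < c ∨ z.2 < y1}
      ((isOpen_lt continuous_const continuous_fst).inter
        (isOpen_lt continuous_const continuous_snd))
      ((isOpen_lt continuous_fst continuous_const).union
        (isOpen_lt continuous_snd continuous_const))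
      (by
        intro z hz
        by_cases h : z.1 < c ∨ z.2 < y1
        · exact Or.inr h
        · push Not at h
          have := hcon z hz h.1 h.2
          exact Or.inl ⟨lt_of_le_of_ne h.1 this.1.symm, lt_of_le_of_ne h.2 this.2.symm⟩)
      ⟨_, hq, h2, hy⟩ ⟨_, hp, Or.inl h1⟩
    obtain ⟨z, -, ⟨a, b⟩, (d | d)⟩ := this <;> linarith
  obtain ⟨⟨a, b⟩, hz, ha, hb, hab⟩ := k1
  obtain ⟨⟨a', b'⟩, hz', ha', hb', hab'⟩ := k2
  simp only at *
  rcases hab with rfl | rfl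
  · rcases hab' with rfl | rfl
    · rcases le_total y1 b with h | h
      · exact ⟨b, h, hb, hz⟩
      · exact ⟨y1, le_refl _, hy.le, hV _ _ _ _ hz hz' h hb'⟩
    · exact ⟨b', le_refl _, hy.le, hH _ _ _ _ hp hz' h1.le ha'⟩
  · exact ⟨b, hy.le, le_refl _, hH _ _ _ _ hz hq ha h2.le⟩

def reflH : (ℝ × ℝ) ≃ₜ (ℝ × ℝ) := (Homeomorph.refl ℝ).prodCongr (Homeomorph.neg ℝ)

structure Good (T : Set (ℝ × ℝ)) : Prop where
  conn : IsPreconnected T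
  hH : ∀ a b c y, (a, y) ∈ T → (b, y) ∈ T → a ≤ c → c ≤ b → (c, y) ∈ T
  hV : ∀ a b c x, (x, a) ∈ T → (x, b) ∈ T → a ≤ c → c ≤ b → (x, c) ∈ T

lemma Good.refl {T : Set (ℝ × ℝ)} (h : Good T) : Good (reflH ⁻¹' T) where
  conn := (reflH.isPreconnected_preimage).2 h.conn
  hH := fun a b c y h1 h2 h3 h4 => h.hH a b c (-y) h1 h2 h3 h4
  hV := fun a b c x h1 h2 h3 h4 => h.hV (-b) (-a) (-c) x h2 h1 (by linarith) (by linarith)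

lemma Good.swap {T : Set (ℝ × ℝ)} (h : Good T) : Good (Homeomorph.prodComm ℝ ℝ ⁻¹' T) where
  conn := ((Homeomorph.prodComm ℝ ℝ).isPreconnected_preimage).2 h.conn
  hH := fun a b c y h1 h2 h3 h4 => h.hV a b c y h1 h2 h3 h4
  hV := fun a b c x h1 h2 h3 h4 => h.hH a b c x h1 h2 h3 h4

lemma Good.A {T : Set (ℝ × ℝ)} (hT : Good T)
    (x1 y1 x2 y2 c : ℝ) (hp : (x1, y1) ∈ T) (hq : (x2, y2) ∈ T)
    (h1 : x1 < c) (h2 : c < x2) : ∃ h, min y1 y2 ≤ h ∧ h ≤ max y1 y2 ∧ (c, h) ∈ T := by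
  rcases le_total y1 y2 with hy | hy
  · rw [min_eq_left hy, max_eq_right hy]
    exact aux_A T hT.1 hT.2 hT.3 x1 y1 x2 y2 c hp hq h1 h2 hy
  · rw [min_eq_right hy, max_eq_left hy]
    have h' := hT.refl
    obtain ⟨h, a, b, d⟩ := aux_A _ h'.1 h'.2 h'.3 x1 (-y1) x2 (-y2) c
      (by simpa [reflH] using hp) (by simpa [reflH] using hq) h1 h2 (by linarith)
    exact ⟨-h, by linarith, by linarith, d⟩

lemma Good.clA {T : Set (ℝ × ℝ)} (hT : Good T)
    (x1 y1 x2 y2 c : ℝ) (hp : (x1, y1) ∈ closure T) (hq : (x2, y2) ∈ closure T)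
    (h1 : x1 < c) (h2 : c < x2) :
    ∃ h, min y1 y2 ≤ h ∧ h ≤ max y1 y2 ∧ (c, h) ∈ closure T := by
  by_contra hcon
  push Not at hcon
  have hcl : IsClosed {h : ℝ | (c, h) ∈ closure T} :=
    isClosed_closure.preimage (by fun_prop : Continuous fun h : ℝ => (c, h))
  obtain ⟨δ, hδ, hsub⟩ := (isCompact_Icc (a := min y1 y2) (b := max y1 y2)).exists_thickening_subset_open
    hcl.isOpen_compl (fun h hh => hcon h hh.1 hh.2)
  obtain ⟨⟨a, b⟩, hab, hd⟩ := Metric.mem_closure_iff.1 hp (min δ (c - x1)) (lt_min hδ (by linarith))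
  obtain ⟨⟨a', b'⟩, hab', hd'⟩ := Metric.mem_closure_iff.1 hq (min δ (x2 - c)) (lt_min hδ (by linarith))
  rw [Prod.dist_eq, max_lt_iff, lt_min_iff, lt_min_iff, Real.dist_eq, Real.dist_eq] at hd hd'
  simp only [abs_lt] at hd hd'
  obtain ⟨h, k1, k2, k3⟩ := hT.A a b a' b' c hab hab' (by linarith) (by linarith)
  refine hsub ?_ (subset_closure k3 : (c, h) ∈ closure T)
  have m1 : min y1 y2 - δ < min b b' := by
    rw [lt_min_iff]
    constructor
    · linarith [min_le_left y1 y2]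
    · linarith [min_le_right y1 y2]
  have m2 : max b b' < max y1 y2 + δ := by
    rw [max_lt_iff]
    constructor
    · linarith [le_max_left y1 y2]
    · linarith [le_max_right y1 y2]
  rw [Metric.mem_thickening_iff]
  have m3 : min y1 y2 ≤ max y1 y2 := min_le_max
  rcases le_total h (min y1 y2) with h' | h'
  · exact ⟨_, Set.left_mem_Icc.2 m3, by rw [Real.dist_eq, abs_lt]; constructor <;> linarith⟩
  rcases le_total h (max y1 y2) with h'' | h''
  · exact ⟨h, ⟨h', h''⟩, by simpa using hδ⟩
  · exact ⟨_, Set.right_mem_Icc.2 m3, by rw [Real.dist_eq, abs_lt]; constructor <;> linarith⟩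

lemma Good.clH {T : Set (ℝ × ℝ)} (hT : Good T) :
    ∀ a b c y, (a, y) ∈ closure T → (b, y) ∈ closure T → a ≤ c → c ≤ b → (c, y) ∈ closure T := by
  intro a b c y h1 h2 h3 h4
  rcases h3.eq_or_lt with rfl | h3
  · exact h1
  rcases h4.eq_or_lt with rfl | h4
  · exact h2
  obtain ⟨h, k1, k2, k3⟩ := hT.clA a y b y c h1 h2 h3 h4
  rw [min_self] at k1
  rw [max_self] at k2
  rwa [le_antisymm k1 k2]

lemma Good.clV {T : Set (ℝ × ℝ)} (hT : Good T) :
    ∀ a b c x, (x, a) ∈ closure T → (x, b) ∈ closure T → a ≤ c → c ≤ b → (x, c) ∈ closure T := by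
  have := hT.swap.clH
  rw [← Homeomorph.preimage_closure] at this
  exact this

lemma Good.joined_le {T : Set (ℝ × ℝ)} (hT : Good T) (p q : ℝ × ℝ)
    (hp : p ∈ closure T) (hq : q ∈ closure T) (hpq : p ≤ q) : JoinedIn (closure T) p q := by
  refine aux_path _ isClosed_closure ?_ p q hp hq hpq
  clear hpq hp hq p q
  rintro ⟨x1, y1⟩ hp ⟨x2, y2⟩ hq ⟨hx, hy⟩ hne
  simp only at hx hy
  rcases hx.eq_or_lt with hx' | hx'
  · subst hx'
    have hy' : y1 < y2 := lt_of_le_of_ne hy (fun h => hne (by rw [h]))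
    refine ⟨(x1, (y1 + y2) / 2), hT.clV y1 y2 _ x1 hp hq (by linarith) (by linarith),
      ⟨le_refl _, by simp only; linarith⟩, ⟨le_refl _, by simp only; linarith⟩, ?_, ?_⟩ <;>
    · intro h
      have := congrArg Prod.snd h
      simp only at this
      linarith
  · obtain ⟨h, k1, k2, k3⟩ := hT.clA x1 y1 x2 y2 ((x1 + x2) / 2) hp hq (by linarith) (by linarith)
    rw [min_eq_left hy] at k1
    rw [max_eq_right hy] at k2
    refine ⟨_, k3, ⟨by simp only; linarith, k1⟩, ⟨by simp only; linarith, k2⟩, ?_, ?_⟩ <;>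
    · intro h
      have := congrArg Prod.fst h
      simp only at this
      linarith

lemma Good.joined_x {T : Set (ℝ × ℝ)} (hT : Good T) (p q : ℝ × ℝ)
    (hp : p ∈ closure T) (hq : q ∈ closure T) (hpq : p.1 ≤ q.1) : JoinedIn (closure T) p q := by
  rcases le_total p.2 q.2 with h | h
  · exact hT.joined_le p q hp hq ⟨hpq, h⟩
  · have hinv : ∀ z, reflH (reflH z) = z := by intro z; exact Prod.ext rfl (neg_neg z.2)
    have := hT.refl.joined_le (reflH p) (reflH q)
      (by rw [← Homeomorph.preimage_closure, Set.mem_preimage, hinv]; exact hp)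
      (by rw [← Homeomorph.preimage_closure, Set.mem_preimage, hinv]; exact hq)
      ⟨hpq, neg_le_neg h⟩
    obtain ⟨γ, hγ⟩ := this
    refine ⟨(γ.map reflH.continuous).cast (hinv p).symm (hinv q).symm, ?_⟩
    intro t
    have := hγ t
    rw [← Homeomorph.preimage_closure] at this
    exact this

lemma Good.pc {T : Set (ℝ × ℝ)} (hT : Good T) (hne : T.Nonempty) :
    IsPathConnected (closure T) := by
  rw [isPathConnected_iff]
  refine ⟨hne.closure, fun p hp q hq => ?_⟩
  rcases le_total p.1 q.1 with h | h
  · exact hT.joined_x p q hp hq h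
  · exact (hT.joined_x q p hq hp h).symm

noncomputable def toE : (ℝ × ℝ) ≃ₜ EuclideanSpace ℝ (Fin 2) where
  toFun z := !₂[z.1, z.2]
  invFun v := (v 0, v 1)
  left_inv z := by simp
  right_inv v := by ext i; fin_cases i <;> simp
  continuous_toFun := by
    apply (PiLp.continuous_toLp 2 _).comp
    refine continuous_pi fun i => ?_
    fin_cases i
    · exact continuous_fst
    · exact continuous_snd
  continuous_invFun := by fun_prop

lemma ortho_iff (S : Set (EuclideanSpace ℝ (Fin 2))) : OrthoConvex S ↔
    (∀ a b c y, (a, y) ∈ toE ⁻¹' S → (b, y) ∈ toE ⁻¹' S → a ≤ c → c ≤ b → (c, y) ∈ toE ⁻¹' S) ∧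
    (∀ a b c x, (x, a) ∈ toE ⁻¹' S → (x, b) ∈ toE ⁻¹' S → a ≤ c → c ≤ b → (x, c) ∈ toE ⁻¹' S) := by
  have e0 : ∀ z, toE z 0 = z.1 := fun z => by simp [toE]
  have e1 : ∀ z, toE z 1 = z.2 := fun z => by simp [toE]
  constructor
  · intro h
    constructor
    · intro a b c y ha hb hac hcb
      have := ((h 0 (toE (a, y))).image (fun p => p 0) (by fun_prop)).ordConnected.out
        ⟨toE (a, y), ⟨ha, fun j _ => rfl⟩, e0 _⟩
        ⟨toE (b, y), ⟨hb, fun j hj => by fin_cases j <;> simp [toE] at *⟩, e0 _⟩ ⟨hac, hcb⟩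
      obtain ⟨p, ⟨hp, hj⟩, hpc⟩ := this
      have hj1 := hj 1 (by simp)
      have : toE (c, y) = p := by
        ext i; fin_cases i
        · exact (e0 _).trans hpc.symm
        · exact (e1 _).trans ((e1 _).symm.trans hj1.symm)
      rw [Set.mem_preimage, this]; exact hp
    · intro a b c x ha hb hac hcb
      have := ((h 1 (toE (x, a))).image (fun p => p 1) (by fun_prop)).ordConnected.out
        ⟨toE (x, a), ⟨ha, fun j _ => rfl⟩, e1 _⟩
        ⟨toE (x, b), ⟨hb, fun j hj => by fin_cases j <;> simp [toE] at *⟩, e1 _⟩ ⟨hac, hcb⟩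
      obtain ⟨p, ⟨hp, hj⟩, hpc⟩ := this
      have hj1 := hj 0 (by simp)
      have : toE (x, c) = p := by
        ext i; fin_cases i
        · exact (e0 _).trans ((e0 _).symm.trans hj1.symm)
        · exact (e1 _).trans hpc.symm
      rw [Set.mem_preimage, this]; exact hp
  · rintro ⟨hH, hV⟩ i c
    have key : ∀ p : EuclideanSpace ℝ (Fin 2), toE (p 0, p 1) = p := fun p => toE.right_inv p
    fin_cases i
    · have hoc : ({x : ℝ | toE (x, c 1) ∈ S}).OrdConnected :=
        ⟨fun a ha b hb z hz => hH a b z _ ha hb hz.1 hz.2⟩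
      have := hoc.isPreconnected.image (fun x => toE (x, c 1))
        (toE.continuous.comp (by fun_prop)).continuousOn
      convert this using 1
      ext p
      constructor
      · rintro ⟨hp, hj⟩
        have h1 : p 1 = c 1 := hj 1 (by simp)
        have h2 : toE (p 0, c 1) = p := by rw [← h1]; exact key p
        exact ⟨p 0, by rw [Set.mem_setOf_eq, h2]; exact hp, h2⟩
      · rintro ⟨x, hx, rfl⟩
        refine ⟨hx, fun j hj => ?_⟩
        fin_cases j
        · exact absurd rfl hj
        · exact e1 _
    · have hoc : ({y : ℝ | toE (c 0, y) ∈ S}).OrdConnected :=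
        ⟨fun a ha b hb z hz => hV a b z _ ha hb hz.1 hz.2⟩
      have := hoc.isPreconnected.image (fun y => toE (c 0, y))
        (toE.continuous.comp (by fun_prop)).continuousOn
      convert this using 1
      ext p
      constructor
      · rintro ⟨hp, hj⟩
        have h1 : p 0 = c 0 := hj 0 (by simp)
        have h2 : toE (c 0, p 1) = p := by rw [← h1]; exact key p
        exact ⟨p 1, by rw [Set.mem_setOf_eq, h2]; exact hp, h2⟩
      · rintro ⟨x, hx, rfl⟩
        refine ⟨hx, fun j hj => ?_⟩
        fin_cases j
        · exact e0 _
        · exact absurd rfl hj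

/-- If `S ⊆ ℝ²` is path-connected and orthogonally convex, then so is its
closure. -/
theorem closure_pathConnected_orthoConvex (S : Set (EuclideanSpace ℝ (Fin 2)))
    (hpc : IsPathConnected S) (hoc : OrthoConvex S) :
    IsPathConnected (closure S) ∧ OrthoConvex (closure S) := by
  obtain ⟨hH, hV⟩ := (ortho_iff S).1 hoc
  have hG : Good (toE ⁻¹' S) :=
    ⟨toE.isPreconnected_preimage.2 hpc.isConnected.isPreconnected, hH, hV⟩
  have hne : (toE ⁻¹' S).Nonempty := hpc.nonempty.preimage toE.surjective
  constructor
  · have := (hG.pc hne).image toE.continuous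
    rwa [← Homeomorph.preimage_closure, Set.image_preimage_eq _ toE.surjective] at this
  · rw [ortho_iff, Homeomorph.preimage_closure]
    exact ⟨hG.clH, hG.clV⟩
end

section
/- Let {Sₙ} be a sequence of nonempty compact, path-connected, and orthogonally convex subsets of ℝ², and suppose {Sₙ} converges to a nonempty compact set S in the Hausdorff metric, i.e., d_H(Sₙ, S) → 0. Then S is orthogonally convex. -/
open Filter

/-- One-sided crossing lemma. -/
theorem half_cross {X : Type*} [TopologicalSpace X] {x y : X → ℝ} (cx : Continuous x)
    (cy : Continuous y) {T : Set X} (hT : IsPreconnected T)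
    (hx : ∀ u ∈ T, ∀ v ∈ T, y u = y v → ∀ s, x u ≤ s → s ≤ x v → ∃ z ∈ T, y z = y u ∧ x z = s)
    {p q : X} (hp : p ∈ T) (hq : q ∈ T) {s h : ℝ} (hps : x p < s) (hqs : s < x q)
    (hph : y p < h) (hqh : y q < h) (hup : ∀ z ∈ T, x z = s → h < y z) : False := by
  have h1 : ∃ u ∈ T, x u ≤ s ∧ y u = h := by
    by_contra! hc
    obtain ⟨z, -, ⟨hz1, hz2⟩, hz3⟩ := hT ({z | x z < s} ∩ {z | y z < h}) ({z | s < x z} ∪ {z | h < y z})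
      ((isOpen_lt cx continuous_const).inter (isOpen_lt cy continuous_const))
      ((isOpen_lt continuous_const cx).union (isOpen_lt continuous_const cy))
      (by
        intro z hz
        have a1 := hc z hz
        have a2 := hup z hz
        simp only [Set.mem_union, Set.mem_inter_iff, Set.mem_ofPred_eq]
        rcases lt_trichotomy (x z) s with h | h | h
        · rcases lt_or_gt_of_ne (a1 h.le) with h' | h' <;> tauto
        · tauto
        · tauto)
      ⟨p, hp, hps, hph⟩ ⟨q, hq, Or.inl hqs⟩
    simp only [Set.mem_union, Set.mem_ofPred_eq] at hz1 hz2 hz3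
    rcases hz3 with h | h <;> linarith
  have h2 : ∃ u ∈ T, s ≤ x u ∧ y u = h := by
    by_contra! hc
    obtain ⟨z, -, ⟨hz1, hz2⟩, hz3⟩ := hT ({z | s < x z} ∩ {z | y z < h}) ({z | x z < s} ∪ {z | h < y z})
      ((isOpen_lt continuous_const cx).inter (isOpen_lt cy continuous_const))
      ((isOpen_lt cx continuous_const).union (isOpen_lt continuous_const cy))
      (by
        intro z hz
        have a1 := hc z hz
        have a2 := hup z hz
        simp only [Set.mem_union, Set.mem_inter_iff, Set.mem_ofPred_eq]
        rcases lt_trichotomy (x z) s with h | h | h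
        · tauto
        · tauto
        · rcases lt_or_gt_of_ne (a1 h.le) with h' | h' <;> tauto)
      ⟨q, hq, hqs, hqh⟩ ⟨p, hp, Or.inl hps⟩
    simp only [Set.mem_union, Set.mem_ofPred_eq] at hz1 hz2 hz3
    rcases hz3 with h | h <;> linarith
  obtain ⟨u, hu, hus, huh⟩ := h1
  obtain ⟨v, hv, hvs, hvh⟩ := h2
  obtain ⟨z, hz, hz1, hz2⟩ := hx u hu v hv (huh.trans hvh.symm) s hus hvs
  have := hup z hz hz2
  linarith

theorem cross {X : Type*} [TopologicalSpace X] {x y : X → ℝ} (cx : Continuous x)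
    (cy : Continuous y) {T : Set X} (hT : IsPreconnected T)
    (hx : ∀ u ∈ T, ∀ v ∈ T, y u = y v → ∀ s, x u ≤ s → s ≤ x v → ∃ z ∈ T, y z = y u ∧ x z = s)
    (hy : ∀ u ∈ T, ∀ v ∈ T, x u = x v → ∀ s, y u ≤ s → s ≤ y v → ∃ z ∈ T, x z = x u ∧ y z = s)
    {p q : X} (hp : p ∈ T) (hq : q ∈ T) {s c ε : ℝ} (hε : 0 < ε) (hps : x p < s) (hqs : s < x q)
    (hpc : |y p - c| < ε) (hqc : |y q - c| < ε) : ∃ z ∈ T, x z = s ∧ |y z - c| ≤ ε := by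
  by_contra! hc
  rw [abs_lt] at hpc hqc
  by_cases hd : ∃ z ∈ T, x z = s ∧ y z ≤ c
  · obtain ⟨u, hu, hus, huc⟩ := hd
    refine half_cross (y := fun z => - y z) cx cy.neg hT ?_ hp hq hps hqs (h := -(c - ε))
      (by linarith) (by linarith) ?_
    · intro u hu v hv huv s h1 h2
      obtain ⟨z, hz, h3, h4⟩ := hx u hu v hv (neg_injective huv) s h1 h2
      exact ⟨z, hz, by simp [h3], h4⟩
    · intro v hv hvs
      by_contra! hcon
      by_cases hvc : y v ≤ c
      · have := hc v hv hvs
        rw [lt_abs] at this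
        rcases this with h | h <;> linarith
      · obtain ⟨z, hz, h1, h2⟩ := hy u hu v hv (hus.trans hvs.symm) c huc (not_le.1 hvc).le
        have := hc z hz (h1.trans hus)
        simp [h2] at this
        linarith
  · push Not at hd
    refine half_cross cx cy hT hx hp hq hps hqs (h := c + ε) (by linarith) (by linarith) ?_
    intro v hv hvs
    have h1 := hd v hv hvs
    have := hc v hv hvs
    rw [lt_abs] at this
    rcases this with h | h <;> linarith

theorem OrthoConvex.slice {T : Set (EuclideanSpace ℝ (Fin 2))} (hT : OrthoConvex T) {i j : Fin 2}
    (hij : ∀ k, k ≠ i ↔ k = j) : ∀ u ∈ T, ∀ v ∈ T, u j = v j → ∀ s, u i ≤ s → s ≤ v i →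
      ∃ z ∈ T, z j = u j ∧ z i = s := by
  intro u hu v hv huv s h1 h2
  have hpre := hT i u
  obtain ⟨z, ⟨hz, hz1⟩, hz2⟩ := hpre.intermediate_value (f := fun z => z i) (a := u) (b := v)
    ⟨hu, fun _ _ => rfl⟩ ⟨hv, fun k hk => by rw [(hij k).1 hk, huv]⟩ (by fun_prop) ⟨h1, h2⟩
  exact ⟨z, hz, hz1 j ((hij j).2 rfl), hz2⟩

/-- If a sequence of nonempty compact, path-connected, and orthogonally convex
subsets of `ℝ²` converges to a nonempty compact set `S` in the Hausdorff
distance, then `S` is orthogonally convex. -/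
theorem orthoConvex_of_hausdorff_limit (Sseq : ℕ → Set (EuclideanSpace ℝ (Fin 2)))
    (S : Set (EuclideanSpace ℝ (Fin 2)))
    (hne : ∀ n : ℕ, (Sseq n).Nonempty) (hcp : ∀ n : ℕ, IsCompact (Sseq n))
    (hpc : ∀ n : ℕ, IsPathConnected (Sseq n)) (hoc : ∀ n : ℕ, OrthoConvex (Sseq n))
    (hSne : S.Nonempty) (hScp : IsCompact S)
    (hlim : Tendsto (fun n => Metric.hausdorffDist (Sseq n) S) atTop (nhds 0)) :
    OrthoConvex S := by
  intro i c
  obtain ⟨j, hij, hji⟩ : ∃ j : Fin 2, (∀ k, k ≠ i ↔ k = j) ∧ (∀ k, k ≠ j ↔ k = i) := by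
    fin_cases i
    · exact ⟨1, by decide, by decide⟩
    · exact ⟨0, by decide, by decide⟩
  have hne' : j ≠ i := (hij j).2 rfl
  have hsum : ∀ f : Fin 2 → ℝ, ∑ k, f k = f i + f j := by
    intro f
    rw [Fin.sum_univ_two]
    fin_cases i <;> fin_cases j <;> simp_all [add_comm]
  let F : ℝ → EuclideanSpace ℝ (Fin 2) := fun t => WithLp.toLp 2 (Function.update (c : Fin 2 → ℝ) i t)
  have hFi : ∀ t, F t i = t := fun t => by simp [F]
  have hFj : ∀ t, F t j = c j := fun t => by simp [F, hne']
  have hFc : Continuous F := by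
    refine (PiLp.continuous_toLp 2 _).comp ?_
    exact continuous_const.update i continuous_id
  have heq : {p ∈ S | ∀ j, j ≠ i → p j = c j} = F '' (F ⁻¹' S) := by
    ext p
    constructor
    · rintro ⟨hp, hpc⟩
      have : F (p i) = p := by
        ext k
        by_cases hk : k = i
        · subst hk; exact hFi _
        · rw [(hij k).1 hk, hFj, hpc j hne']
      exact ⟨p i, by rw [Set.mem_preimage, this]; exact hp, this⟩
    · rintro ⟨t, ht, rfl⟩
      exact ⟨ht, fun k hk => by rw [(hij k).1 hk, hFj]⟩
  rw [heq]
  refine IsPreconnected.image ?_ F hFc.continuousOn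
  apply Set.OrdConnected.isPreconnected
  refine ⟨fun a ha b hb s ⟨has, hsb⟩ => ?_⟩
  rcases has.eq_or_lt with rfl | has
  · exact ha
  rcases hsb.eq_or_lt with rfl | hsb
  · exact hb
  rw [Set.mem_preimage, ← hScp.isClosed.closure_eq, Metric.mem_closure_iff]
  intro ε hε
  obtain ⟨δ, hδ0, hδε, hδa, hδb⟩ : ∃ δ > 0, 2 * δ ≤ ε ∧ δ ≤ s - a ∧ δ ≤ b - s :=
    ⟨min (ε / 2) (min (s - a) (b - s)), by
      simp only [gt_iff_lt, lt_min_iff]; exact ⟨by linarith, by linarith, by linarith⟩,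
      by linarith [min_le_left (ε / 2) (min (s - a) (b - s))],
      (min_le_right _ _).trans (min_le_left _ _), (min_le_right _ _).trans (min_le_right _ _)⟩
  obtain ⟨n, hn⟩ := (hlim.eventually (gt_mem_nhds hδ0)).exists
  have hfin := Metric.hausdorffEDist_ne_top_of_nonempty_of_bounded (hne n) hSne
    (hcp n).isBounded hScp.isBounded
  obtain ⟨p, hp, hpa⟩ := Metric.exists_dist_lt_of_hausdorffDist_lt' (show F a ∈ S from ha) hn hfin
  obtain ⟨q, hq, hqb⟩ := Metric.exists_dist_lt_of_hausdorffDist_lt' (show F b ∈ S from hb) hn hfin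
  have hcoord : ∀ (u v : EuclideanSpace ℝ (Fin 2)) k, |u k - v k| ≤ dist u v := by
    intro u v k
    rw [dist_eq_norm]
    exact PiLp.norm_apply_le (u - v) k
  have p1 := (hcoord p (F a) i).trans_lt hpa
  have p2 := (hcoord p (F a) j).trans_lt hpa
  have q1 := (hcoord q (F b) i).trans_lt hqb
  have q2 := (hcoord q (F b) j).trans_lt hqb
  rw [hFi, abs_lt] at p1 q1
  rw [hFj] at p2 q2
  obtain ⟨z, hz, hz1, hz2⟩ := cross (x := fun z : EuclideanSpace ℝ (Fin 2) => z i)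
    (y := fun z => z j) (by fun_prop) (by fun_prop) (hpc n).isConnected.isPreconnected
    ((hoc n).slice hij) ((hoc n).slice hji) hp hq hδ0 (s := s) (c := c j)
    (by linarith) (by linarith) p2 q2
  obtain ⟨w, hw, hzw⟩ := Metric.exists_dist_lt_of_hausdorffDist_lt hz hn hfin
  refine ⟨w, hw, ?_⟩
  have hrz : dist (F s) z ≤ δ := by
    rw [EuclideanSpace.dist_eq, hsum, hFi, hFj, hz1, dist_self, dist_comm, Real.dist_eq]
    simpa [Real.sqrt_sq_eq_abs] using hz2
  linarith [dist_triangle (F s) z w]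
end

section
/- Blaschke-type theorem: Let F be a uniformly bounded infinite sequence of nonempty compact, path-connected, and orthogonally convex sets in ℝ². Then F contains a subsequence that converges in the Hausdorff metric to a nonempty compact and orthogonally convex set. -/
open Filter

theorem ocx_core {E : Type*} [TopologicalSpace E] {F : Set E} (hF : IsPreconnected F)
    {X Y : E → ℝ} (hX : Continuous X) (hY : Continuous Y) {m h : ℝ}
    (hV : ∀ p ∈ F, X p = m → h < Y p) (hL : ∀ p ∈ F, Y p = h → m < X p)
    {a b : E} (ha : a ∈ F) (hb : b ∈ F) (hXa : X a < m) (hYa : Y a ≤ h) (hXb : m < X b) :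
    False := by
  have hU : IsOpen {p | X p < m ∧ Y p < h} :=
    (isOpen_lt hX continuous_const).inter (isOpen_lt hY continuous_const)
  have hW : IsOpen {p | m < X p ∨ h < Y p} :=
    (isOpen_lt continuous_const hX).union (isOpen_lt continuous_const hY)
  have hcov : F ⊆ {p | X p < m ∧ Y p < h} ∪ {p | m < X p ∨ h < Y p} := by
    intro p hp
    simp only [Set.mem_union, Set.mem_ofPred_eq]
    rcases lt_trichotomy (X p) m with h1 | h1 | h1
    · rcases lt_trichotomy (Y p) h with h2 | h2 | h2
      · exact Or.inl ⟨h1, h2⟩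
      · exact Or.inr (Or.inl (hL p hp h2))
      · exact Or.inr (Or.inr h2)
    · exact Or.inr (Or.inr (hV p hp h1))
    · exact Or.inr (Or.inl h1)
  have haU : Y a < h := by
    rcases hYa.lt_or_eq with h1 | h1
    · exact h1
    · exact absurd (hL a ha h1) (not_lt.2 hXa.le)
  obtain ⟨p, _, ⟨h1, h2⟩, h3⟩ := hF _ _ hU hW hcov ⟨a, ha, hXa, haU⟩ ⟨b, hb, Or.inl hXb⟩
  rcases h3 with h3 | h3
  · exact lt_asymm h1 h3
  · exact lt_asymm h2 h3

theorem ocx_above {E : Type*} [TopologicalSpace E] {F : Set E} (hF : IsPreconnected F)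
    {X Y : E → ℝ} (hX : Continuous X) (hY : Continuous Y) {m y r : ℝ}
    (hH : ∀ p ∈ F, ∀ q ∈ F, Y p = Y q → ∀ x, X p ≤ x → x ≤ X q → ∃ z ∈ F, X z = x ∧ Y z = Y p)
    (hV : ∀ p ∈ F, X p = m → y + r ≤ Y p)
    {a b : E} (ha : a ∈ F) (hb : b ∈ F) (hXa : X a < m) (hXb : m < X b)
    (hYa : Y a < y + r) (hYb : Y b < y + r) : False := by
  have hh : max (Y a) (Y b) < y + r := max_lt hYa hYb
  have h1 : ∀ p ∈ F, X p = m → max (Y a) (Y b) < Y p := fun p hp hm => hh.trans_le (hV p hp hm)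
  by_cases hL : ∀ p ∈ F, Y p = max (Y a) (Y b) → m < X p
  · exact ocx_core hF hX hY h1 hL ha hb hXa (le_max_left _ _) hXb
  · push Not at hL
    obtain ⟨p, hp, hpY, hpX⟩ := hL
    refine ocx_core hF (X := fun e => -X e) hX.neg hY (m := -m) (h := max (Y a) (Y b)) (a := b) (b := a)
      (fun q hq hm => h1 q hq (neg_inj.1 hm)) ?_ hb ha (neg_lt_neg hXb) (le_max_right _ _)
      (neg_lt_neg hXa)
    intro q hq hqY
    by_contra hc
    have hc' : m ≤ X q := by linarith [not_lt.1 hc]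
    obtain ⟨z, hz, hzX, hzY⟩ := hH p hp q hq (hpY.trans hqY.symm) m hpX hc'
    have := h1 z hz hzX
    linarith

theorem ocx_gap {E : Type*} [TopologicalSpace E] {F : Set E} (hF : IsPreconnected F)
    {X Y : E → ℝ} (hX : Continuous X) (hY : Continuous Y) {m y r : ℝ} (hr : 0 < r)
    (hH : ∀ p ∈ F, ∀ q ∈ F, Y p = Y q → ∀ x, X p ≤ x → x ≤ X q → ∃ z ∈ F, X z = x ∧ Y z = Y p)
    (hV : ∀ p ∈ F, ∀ q ∈ F, X p = X q → ∀ x, Y p ≤ x → x ≤ Y q → ∃ z ∈ F, Y z = x ∧ X z = X p)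
    (hB : ∀ p ∈ F, X p = m → r ≤ |Y p - y|)
    {a b : E} (ha : a ∈ F) (hb : b ∈ F) (hXa : X a < m) (hXb : m < X b)
    (hYa : |Y a - y| < r) (hYb : |Y b - y| < r) : False := by
  rw [abs_lt] at hYa hYb
  by_cases hc : ∀ p ∈ F, X p = m → y + r ≤ Y p
  · exact ocx_above hF hX hY hH hc ha hb hXa hXb (by linarith) (by linarith)
  · push Not at hc
    obtain ⟨p, hp, hpX, hpY⟩ := hc
    have hp2 : Y p ≤ y := by
      rcases le_abs.1 (hB p hp hpX) with h | h <;> linarith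
    refine ocx_above hF hX (Y := fun e => -Y e) hY.neg (m := m) (y := -y) (r := r) ?_ ?_ ha hb hXa hXb
      (by linarith) (by linarith)
    · intro p hp q hq hpq x h1 h2
      obtain ⟨z, hz, h3, h4⟩ := hH p hp q hq (neg_inj.1 hpq) x h1 h2
      exact ⟨z, hz, h3, neg_inj.2 h4⟩
    · intro q hq hqX
      rcases le_abs.1 (hB q hq hqX) with h | h
      · obtain ⟨z, hz, hzY, hzX⟩ := hV p hp q hq (hpX.trans hqX.symm) y hp2 (by linarith)
        have := hB z hz (hzX.trans hpX)
        rw [hzY, sub_self, abs_zero] at this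
        linarith
      · linarith

theorem ocx_slice {F : Set (EuclideanSpace ℝ (Fin 2))} (hF : OrthoConvex F) {i j : Fin 2}
    (hij : ∀ k, k ≠ i ↔ k = j) :
    ∀ p ∈ F, ∀ q ∈ F, p j = q j → ∀ x, p i ≤ x → x ≤ q i → ∃ z ∈ F, z i = x ∧ z j = p j := by
  intro p hp q hq hpq x h1 h2
  have hc : Continuous fun p : EuclideanSpace ℝ (Fin 2) => p i := by fun_prop
  have h := ((hF i p).image _ hc.continuousOn).ordConnected
  obtain ⟨z, ⟨hz, hz2⟩, hzx⟩ := h.out ⟨p, ⟨hp, fun _ _ => rfl⟩, rfl⟩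
    ⟨q, ⟨hq, fun k hk => by rw [(hij k).1 hk, hpq]⟩, rfl⟩ ⟨h1, h2⟩
  exact ⟨z, hz, hzx, hz2 j ((hij j).2 rfl)⟩

theorem ocx_of_slice {S : Set (EuclideanSpace ℝ (Fin 2))} 
    (h : ∀ i j : Fin 2, (∀ k, k ≠ i ↔ k = j) → ∀ p ∈ S, ∀ q ∈ S, ∀ m ∉ S, p j = m j → q j = m j →
      p i < m i → m i < q i → False) : OrthoConvex S := by
  intro i c
  obtain ⟨j, hij⟩ : ∃ j : Fin 2, ∀ k, k ≠ i ↔ k = j := by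
    fin_cases i
    · exact ⟨1, by decide⟩
    · exact ⟨0, by decide⟩
  have hji : j ≠ i := (hij j).2 rfl
  let f : ℝ → EuclideanSpace ℝ (Fin 2) := fun t => WithLp.toLp 2 (Function.update (fun k => c k) i t)
  have hf : Continuous f := by
    have : Continuous fun t : ℝ => Function.update (fun k => c k) i t :=
      continuous_const.update i continuous_id
    exact (PiLp.continuous_toLp 2 _).comp this
  have hfi : ∀ t, f t i = t := fun t => by simp [f]
  have hfj : ∀ t, f t j = c j := fun t => by simp [f, hji]
  have heq : {p ∈ S | ∀ k, k ≠ i → p k = c k} = f '' {t | f t ∈ S} := by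
    ext p
    constructor
    · rintro ⟨hp, hpc⟩
      have : f (p i) = p := by
        ext k
        by_cases hk : k = i
        · rw [hk, hfi]
        · rw [hpc k hk, (hij k).1 hk, hfj]
      exact ⟨p i, by simpa only [Set.mem_ofPred_eq, this] using hp, this⟩
    · rintro ⟨t, ht, rfl⟩
      exact ⟨ht, fun k hk => by rw [(hij k).1 hk, hfj]⟩
  rw [heq]
  refine IsPreconnected.image (Set.OrdConnected.isPreconnected ⟨?_⟩) _ hf.continuousOn
  intro s hs t ht u hu
  by_contra hc
  rcases hu.1.lt_or_eq with h1 | rfl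
  · rcases hu.2.lt_or_eq with h2 | rfl
    · exact h i j hij (f s) hs (f t) ht (f u) hc (by rw [hfj, hfj]) (by rw [hfj, hfj])
        (by rw [hfi, hfi]; exact h1) (by rw [hfi, hfi]; exact h2)
    · exact hc ht
  · exact hc hs

theorem ocx_coord (p q : EuclideanSpace ℝ (Fin 2)) (i : Fin 2) : |p i - q i| ≤ dist p q := by
  rw [dist_eq_norm]
  exact PiLp.norm_apply_le (p - q) i

theorem ocx_dist {p q : EuclideanSpace ℝ (Fin 2)} {i j : Fin 2} (hij : ∀ k, k ≠ i ↔ k = j)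
    (h : p i = q i) : dist p q = |p j - q j| := by
  have hs : ∀ g : Fin 2 → ℝ, g i = 0 → ∑ k, g k = g j := fun g hg =>
    Finset.sum_eq_single j (fun k _ hk => by
      have : k = i := by by_contra hne; exact hk ((hij k).1 hne)
      rw [this, hg]) (by simp)
  rw [EuclideanSpace.dist_eq, hs (fun k => dist (p k) (q k) ^ 2) (by simp [h]),
    Real.sqrt_sq dist_nonneg, Real.dist_eq]

/-- Blaschke-type theorem: a uniformly bounded sequence of nonempty compact,
path-connected, and orthogonally convex sets in `ℝ²` has a subsequence
converging in the Hausdorff distance to a nonempty compact orthogonally convex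
set. -/
theorem blaschke_orthoConvex (F : ℕ → Set (EuclideanSpace ℝ (Fin 2)))
    (R : ℝ) (hbd : ∀ n : ℕ, F n ⊆ Metric.closedBall 0 R)
    (hne : ∀ n : ℕ, (F n).Nonempty) (hcp : ∀ n : ℕ, IsCompact (F n))
    (hpc : ∀ n : ℕ, IsPathConnected (F n)) (hoc : ∀ n : ℕ, OrthoConvex (F n)) :
    ∃ (φ : ℕ → ℕ) (S : Set (EuclideanSpace ℝ (Fin 2))), StrictMono φ ∧
      S.Nonempty ∧ IsCompact S ∧ OrthoConvex S ∧
      Tendsto (fun n => Metric.hausdorffDist (F (φ n)) S) atTop (nhds 0) := by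
  let K : ℕ → TopologicalSpace.NonemptyCompacts (EuclideanSpace ℝ (Fin 2)) :=
    fun n => ⟨⟨F n, hcp n⟩, hne n⟩
  have hK : ∀ n, (K n : Set (EuclideanSpace ℝ (Fin 2))) = F n := fun n => rfl
  obtain ⟨L, _, φ, hφ, hlim⟩ :=
    (TopologicalSpace.NonemptyCompacts.isCompact_subsets_of_isCompact
      (isCompact_closedBall (0 : EuclideanSpace ℝ (Fin 2)) R)).tendsto_subseq
      (x := K) (fun n => hbd n)
  have hT : Tendsto (fun n => Metric.hausdorffDist (F (φ n)) (L : Set _)) atTop (nhds 0) := by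
    have := tendsto_iff_dist_tendsto_zero.1 hlim
    simpa only [Metric.NonemptyCompacts.dist_eq, Function.comp, hK] using this
  refine ⟨φ, L, hφ, L.nonempty, L.isCompact, ocx_of_slice ?_, hT⟩
  intro i j hij p hp q hq m hm hpj hqj hpi hqi
  obtain ⟨ρ, hρ, hball⟩ := Metric.isOpen_iff.1 L.isCompact.isClosed.isOpen_compl m hm
  obtain ⟨δ, hδ, h1, h2, h3⟩ : ∃ δ > 0, δ ≤ ρ / 2 ∧ δ ≤ m i - p i ∧ δ ≤ q i - m i :=
    ⟨min (ρ / 2) (min (m i - p i) (q i - m i)),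
      lt_min (by linarith) (lt_min (by linarith) (by linarith)), min_le_left _ _,
      (min_le_right _ _).trans (min_le_left _ _), (min_le_right _ _).trans (min_le_right _ _)⟩
  obtain ⟨n, hn⟩ := (hT.eventually (gt_mem_nhds hδ)).exists
  have hfin : Metric.hausdorffEDist (F (φ n)) (L : Set _) ≠ ⊤ :=
    Metric.hausdorffEDist_ne_top_of_nonempty_of_bounded (hne _) L.nonempty
      (hcp _).isBounded L.isCompact.isBounded
  obtain ⟨a, ha, hap⟩ := Metric.exists_dist_lt_of_hausdorffDist_lt' hp hn hfin
  obtain ⟨b, hb, hbq⟩ := Metric.exists_dist_lt_of_hausdorffDist_lt' hq hn hfin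
  have hji : ∀ k, k ≠ j ↔ k = i := by
    intro k
    rw [not_iff_comm, ← hij k]
  have hai := (ocx_coord a p i).trans_lt hap
  have haj := (ocx_coord a p j).trans_lt hap
  have hbi := (ocx_coord b q i).trans_lt hbq
  have hbj := (ocx_coord b q j).trans_lt hbq
  rw [hpj] at haj
  rw [hqj] at hbj
  rw [abs_lt] at hai hbi
  refine ocx_gap (F := F (φ n)) (X := fun p => p i) (Y := fun p => p j) (m := m i) (y := m j)
    (r := ρ / 2) (hpc _).isConnected.isPreconnected (by fun_prop) (by fun_prop) (by linarith)
    (ocx_slice (hoc _) hij) (ocx_slice (hoc _) hji) ?_ ha hb (by linarith) (by linarith)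
    (by linarith) (by linarith)
  intro z hz hzi
  by_contra hlt
  rw [← ocx_dist hij hzi, not_le] at hlt
  obtain ⟨w, hw, hzw⟩ := Metric.exists_dist_lt_of_hausdorffDist_lt hz hn hfin
  refine hball (Metric.mem_ball.2 ?_) hw
  have := dist_triangle w z m
  rw [dist_comm w z] at this
  linarith
end

section
/- Let S ⊆ ℝ² be a closed, path-connected, and orthogonally convex set, and let p ∉ S. Then there exists a staircase line strictly separating S and p. -/
/-- The ray issuing from `p` through `q`. -/
def Ray (p q : EuclideanSpace ℝ (Fin 2)) : Set (EuclideanSpace ℝ (Fin 2)) :=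
  {x | ∃ t : ℝ, 0 ≤ t ∧ x = p + t • (q - p)}

/-- `L ⊆ ℝ²` is a staircase line if it is obtained from a simple polyline
`v₀v₁…vₙ` made of nondegenerate axis-aligned segments, in which all step
vectors with odd index have the same direction and all step vectors with even
index have the same direction, by replacing the first segment `v₀v₁` by the
ray from `v₁` through `v₀` and the last segment `v_{n-1}vₙ` by the ray from
`v_{n-1}` through `vₙ`.  Simplicity of the resulting curve is expressed by the
existence of an injective continuous parametrization of `L` by `ℝ`. -/
def IsStaircaseLine (L : Set (EuclideanSpace ℝ (Fin 2))) : Prop :=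
  ∃ (n : ℕ) (v : ℕ → EuclideanSpace ℝ (Fin 2)), 1 ≤ n ∧
    (∀ i : ℕ, 1 ≤ i → i ≤ n →
      v (i - 1) ≠ v i ∧ ((v (i - 1)) 0 = (v i) 0 ∨ (v (i - 1)) 1 = (v i) 1)) ∧
    (∀ i j : ℕ, 1 ≤ i → i ≤ n → 1 ≤ j → j ≤ n → i % 2 = j % 2 →
      ∃ t : ℝ, 0 < t ∧ v j - v (j - 1) = t • (v i - v (i - 1))) ∧
    (∃ φ : ℝ → EuclideanSpace ℝ (Fin 2),
      Continuous φ ∧ Function.Injective φ ∧ Set.range φ = L) ∧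
    L = Ray (v 1) (v 0) ∪ Ray (v (n - 1)) (v n) ∪
      ⋃ i ∈ Set.Ico 1 (n - 1), segment ℝ (v i) (v (i + 1))

/-- A staircase-halfplane is a closed subset of `ℝ²` whose boundary is a
staircase line. -/
def IsStaircaseHalfplane (H : Set (EuclideanSpace ℝ (Fin 2))) : Prop :=
  IsClosed H ∧ IsStaircaseLine (frontier H)

/-- A staircase line `L` strictly separates `A` and `B` if of the two
staircase-halfplanes bounded by `L` (whose union is the plane) one contains
`A` and the other contains `B`, and neither `A` nor `B` meets `L`. -/
def StrictlySeparates (L A B : Set (EuclideanSpace ℝ (Fin 2))) : Prop :=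
  IsStaircaseLine L ∧
    ∃ H₁ H₂ : Set (EuclideanSpace ℝ (Fin 2)),
      IsStaircaseHalfplane H₁ ∧ IsStaircaseHalfplane H₂ ∧
      frontier H₁ = L ∧ frontier H₂ = L ∧ H₁ ∪ H₂ = Set.univ ∧
      A ⊆ H₁ ∧ B ⊆ H₂ ∧ Disjoint A L ∧ Disjoint B L

abbrev E2 := EuclideanSpace ℝ (Fin 2)

theorem E2_ext {a b : E2} (h0 : a 0 = b 0) (h1 : a 1 = b 1) : a = b := by
  ext i; fin_cases i <;> assumption

theorem frontier_le_aux (f : E2 → ℝ) (d : E2) (hf : Continuous f)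
    (hd : ∀ q t, f (q + t • d) = f q + t) : frontier {q | f q ≤ 0} = {q | f q = 0} := by
  apply subset_antisymm
  · exact frontier_le_subset_eq hf continuous_const
  · intro q hq
    have hq : f q = 0 := hq
    rw [(isClosed_le hf continuous_const).frontier_eq]
    refine ⟨le_of_eq hq, fun hi => ?_⟩
    have hc : Continuous (fun t : ℝ => q + t • d) := by fun_prop
    have h1 : ∀ᶠ t in nhds (0:ℝ), q + t • d ∈ {q | f q ≤ 0} := by
      apply hc.continuousAt.eventually_mem
      simpa using mem_interior_iff_mem_nhds.1 hi
    obtain ⟨ε, hε, h2⟩ := Metric.eventually_nhds_iff.1 h1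
    have := @h2 (ε/2) (by rw [Real.dist_eq, sub_zero, abs_of_pos] <;> linarith)
    have h3 : f (q + (ε/2) • d) ≤ 0 := this
    rw [hd] at h3
    linarith

theorem sep_of_f (f : E2 → ℝ) (d : E2) (hf : Continuous f)
    (hd : ∀ q t, f (q + t • d) = f q + t) (hd2 : d 0 * d 0 + d 1 * d 1 = 2)
    (n : ℕ) (v : ℕ → E2) (hn : 1 ≤ n)
    (hv1 : ∀ i : ℕ, 1 ≤ i → i ≤ n →
      v (i - 1) ≠ v i ∧ ((v (i - 1)) 0 = (v i) 0 ∨ (v (i - 1)) 1 = (v i) 1))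
    (hv2 : ∀ i j : ℕ, 1 ≤ i → i ≤ n → 1 ≤ j → j ≤ n → i % 2 = j % 2 →
      ∃ t : ℝ, 0 < t ∧ v j - v (j - 1) = t • (v i - v (i - 1)))
    (hL : {q | f q = 0} = Ray (v 1) (v 0) ∪ Ray (v (n - 1)) (v n) ∪
      ⋃ i ∈ Set.Ico 1 (n - 1), segment ℝ (v i) (v (i + 1)))
    (S : Set E2) (p : E2) (hS : ∀ q ∈ S, f q < 0) (hp : 0 < f p) :
    ∃ L : Set E2, StrictlySeparates L S {p} := by
  have hline : IsStaircaseLine {q | f q = 0} := by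
    refine ⟨n, v, hn, hv1, hv2, ?_, hL⟩
    let w : E2 := !₂[-d 1, d 0]
    have w0 : w 0 = - d 1 := rfl
    have w1 : w 1 = d 0 := rfl
    refine ⟨fun s => s • w + (- f (s • w)) • d, by fun_prop, ?_, ?_⟩
    · intro s s' h
      have h0 := congrArg (fun q : E2 => q 0) h
      have h1 := congrArg (fun q : E2 => q 1) h
      simp [w0, w1] at h0 h1
      linear_combination (1/2) * (-d 1 * h0 + d 0 * h1) - (1/2) * (s - s') * hd2
    · ext q
      constructor
      · rintro ⟨s, rfl⟩
        change f (_ + _) = 0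
        rw [hd]; ring
      · intro hq
        have hq : f q = 0 := hq
        have key : ((- q 0 * d 1 + q 1 * d 0)/2) • w = q + (-((q 0 * d 0 + q 1 * d 1)/2)) • d := by
          apply E2_ext
          · simp [w0]
            linear_combination (1/2) * q 0 * hd2
          · simp [w1]
            linear_combination (1/2) * q 1 * hd2
        refine ⟨(- q 0 * d 1 + q 1 * d 0)/2, ?_⟩
        change _ • w + (- f (_ • w)) • d = q
        rw [key, hd, hq]
        apply E2_ext <;> simp
  have hf1 : frontier {q | f q ≤ 0} = {q | f q = 0} := frontier_le_aux f d hf hd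
  have hf2 : frontier {q | 0 ≤ f q} = {q | f q = 0} := by
    have := frontier_le_aux (fun q => - f q) (-d) hf.neg (by
      intro q t
      have := hd q (-t)
      simp only [neg_smul] at this
      simp only [smul_neg, this]; ring)
    simpa using this
  refine ⟨_, hline, {q | f q ≤ 0}, {q | 0 ≤ f q}, ⟨isClosed_le hf continuous_const, by rwa [hf1]⟩,
    ⟨isClosed_le continuous_const hf, by rwa [hf2]⟩, hf1, hf2, ?_, ?_, ?_, ?_, ?_⟩
  · ext q; simp [le_total]
  · intro q hq; exact (hS q hq).le
  · rintro q rfl; exact hp.le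
  · rw [Set.disjoint_left]; intro q hq h; exact (hS q hq).ne h
  · rw [Set.disjoint_left]; rintro q rfl h; exact hp.ne' h

theorem neg_of_conn (S : Set E2) (hS : IsPreconnected S) (f : E2 → ℝ) (hf : Continuous f)
    (h0 : ∀ q ∈ S, f q ≠ 0) (a : E2) (ha : a ∈ S) (hfa : f a < 0) : ∀ q ∈ S, f q < 0 := by
  intro q hq
  by_contra h
  push Not at h
  obtain ⟨r, hr, hr0⟩ := hS.intermediate_value ha hq hf.continuousOn ⟨hfa.le, h⟩
  exact h0 r hr hr0

/-- one corner at `(a, b)` -/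
theorem sep_quadrant (σ a b : ℝ) (hσ : σ = 1 ∨ σ = -1) (S : Set E2) (p : E2)
    (hS : ∀ q ∈ S, min (σ * (q 0 - a)) (σ * (q 1 - b)) < 0)
    (hp : 0 < min (σ * (p 0 - a)) (σ * (p 1 - b))) :
    ∃ L : Set E2, StrictlySeparates L S {p} := by
  have hs2 : σ * σ = 1 := by rcases hσ with rfl | rfl <;> norm_num
  have hs0 : σ ≠ 0 := by rintro rfl; norm_num at hs2
  refine sep_of_f (fun q => min (σ * (q 0 - a)) (σ * (q 1 - b))) !₂[σ, σ] (by fun_prop) ?_ ?_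
    2 (fun i => if i = 0 then !₂[a, b + σ] else if i = 1 then !₂[a, b] else !₂[a + σ, b])
    (by norm_num) ?_ ?_ ?_ S p hS hp
  · intro q t
    rw [← min_add_add_right]
    congr 1
    · simp; linear_combination t * hs2
    · simp; linear_combination t * hs2
  · simp; linarith
  · intro i h1 h2
    interval_cases i
    · constructor
      · intro h
        have := congrArg (fun q : E2 => q 1) h
        simp at this; exact hs0 this
      · simp
    · constructor
      · intro h
        have := congrArg (fun q : E2 => q 0) h
        simp at this; exact hs0 this
      · simp
  · intro i j h1 h2 h3 h4 h5
    have : i = j := by omega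
    subst this
    exact ⟨1, one_pos, by simp⟩
  · ext q
    simp only [Set.mem_setOf_eq, Set.mem_union, Ray]
    simp
    constructor
    · intro h
      rcases min_choice (σ * (q 0 - a)) (σ * (q 1 - b)) with h' | h'
      · left
        refine ⟨σ * (q 1 - b), ?_, ?_⟩
        · rw [← h]; exact min_le_right _ _
        · rw [h] at h'
          have : q 0 - a = 0 := by
            rcases mul_eq_zero.1 h'.symm with h | h
            · exact absurd h hs0
            · exact h
          apply E2_ext
          · simp; linarith
          · simp; linear_combination -(q 1 - b) * hs2
      · right
        refine ⟨σ * (q 0 - a), ?_, ?_⟩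
        · rw [← h]; exact min_le_left _ _
        · rw [h] at h'
          have : q 1 - b = 0 := by
            rcases mul_eq_zero.1 h'.symm with h | h
            · exact absurd h hs0
            · exact h
          apply E2_ext
          · simp; linear_combination -(q 0 - a) * hs2
          · simp; linarith
    · have key : ∀ t, σ * (t * σ) = t := fun t => by linear_combination t * hs2
      rintro (⟨t, ht, rfl⟩ | ⟨t, ht, rfl⟩)
      · simp [key, ht]
      · simp [key, ht]

/-- two corners -/
theorem sep_step (a b c : ℝ) (hc : 0 < c) (S : Set E2) (p : E2)
    (hS : ∀ q ∈ S, max (q 1 - b) (min (q 1 - b + c) (a - q 0)) < 0)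
    (hp : 0 < max (p 1 - b) (min (p 1 - b + c) (a - p 0))) :
    ∃ L : Set E2, StrictlySeparates L S {p} := by
  refine sep_of_f (fun q => max (q 1 - b) (min (q 1 - b + c) (a - q 0))) !₂[-1, 1] (by fun_prop) ?_ ?_
    3 (fun i => if i = 0 then !₂[a - 1, b - c] else if i = 1 then !₂[a, b - c] else
      if i = 2 then !₂[a, b] else !₂[a + 1, b])
    (by norm_num) ?_ ?_ ?_ S p hS hp
  · intro q t
    rw [← max_add_add_right, ← min_add_add_right]
    congr 1
    · simp; ring
    · congr 1
      · simp; ring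
      · simp; ring
  · simp; norm_num
  · intro i h1 h2
    interval_cases i
    · constructor
      · intro h
        have := congrArg (fun q : E2 => q 0) h
        simp at this
      · simp
    · constructor
      · intro h
        have := congrArg (fun q : E2 => q 1) h
        simp at this; linarith
      · simp
    · constructor
      · intro h
        have := congrArg (fun q : E2 => q 0) h
        simp at this
      · simp
  · intro i j h1 h2 h3 h4 h5
    refine ⟨1, one_pos, ?_⟩
    interval_cases i <;> interval_cases j <;> first | omega | skip
    all_goals apply E2_ext <;> simp
  · ext q
    have hI : Set.Ico 1 (3 - 1) = {1} := by ext i; simp; omega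
    rw [hI]
    simp only [Set.mem_setOf_eq, Set.mem_union, Ray, Set.mem_singleton_iff, Set.iUnion_iUnion_eq_left,
      segment_eq_image']
    simp
    constructor
    · intro h
      by_cases h1 : q 1 - b = 0
      · by_cases h2 : a ≤ q 0
        · left; right
          refine ⟨q 0 - a, by linarith, ?_⟩
          apply E2_ext <;> simp <;> linarith
        · exfalso
          have := le_max_right (q 1 - b) (min (q 1 - b + c) (a - q 0))
          rw [h] at this
          have h3 : 0 < min (q 1 - b + c) (a - q 0) := lt_min (by linarith) (by linarith)
          linarith
      · have hle := le_max_left (q 1 - b) (min (q 1 - b + c) (a - q 0))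
        rw [h] at hle
        have hm : min (q 1 - b + c) (a - q 0) = 0 := by
          rcases max_choice (q 1 - b) (min (q 1 - b + c) (a - q 0)) with h' | h'
          · exact absurd (by linarith) h1
          · linarith
        have m1 := min_le_left (q 1 - b + c) (a - q 0)
        have m2 := min_le_right (q 1 - b + c) (a - q 0)
        rcases min_choice (q 1 - b + c) (a - q 0) with h' | h'
        · left; left
          refine ⟨a - q 0, by linarith, ?_⟩
          apply E2_ext <;> simp <;> linarith
        · right
          refine ⟨(q 1 - b + c) / c, ⟨div_nonneg (by linarith) hc.le, ?_⟩, ?_⟩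
          · rw [div_le_one hc]; linarith
          · apply E2_ext
            · simp; linarith
            · simp; field_simp; ring
    · rintro ((⟨t, ht, rfl⟩ | ⟨t, ht, rfl⟩) | ⟨t, ⟨ht, ht'⟩, rfl⟩)
      · have : max (-c) 0 = 0 := max_eq_right (by linarith)
        simp [ht, this]
        try linarith
      · simp
        right; linarith
      · have h1 : min (t * c) 0 = 0 := min_eq_right (by positivity)
        have h2 : max (b - c + t * c - b) 0 = 0 := max_eq_right (by nlinarith)
        have h3 : b - c + t * c - b + c = t * c := by ring
        simp [h1, h2, h3]

theorem box_exists (S : Set E2) (hcl : IsClosed S) (p : E2) (hp : p ∉ S) :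
    ∃ ε > 0, ∀ q ∈ S, |q 0 - p 0| ≤ ε → |q 1 - p 1| ≤ ε → False := by
  obtain ⟨r, hr, h⟩ := Metric.isOpen_iff.1 hcl.isOpen_compl p hp
  refine ⟨r / 2, by linarith, fun q hq h0 h1 => h ?_ hq⟩
  rw [Metric.mem_ball, EuclideanSpace.dist_eq, Real.sqrt_lt' hr]
  simp [Real.dist_eq]
  rw [← sq_abs (q 0 - p 0), ← sq_abs (q 1 - p 1)]
  nlinarith [abs_nonneg (q 0 - p 0), abs_nonneg (q 1 - p 1)]

def HConv (S : Set E2) : Prop := ∀ a ∈ S, ∀ b ∈ S, a 1 = b 1 → ∀ r : E2, r 1 = a 1 →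
  a 0 ≤ r 0 → r 0 ≤ b 0 → r ∈ S

def VConv (S : Set E2) : Prop := ∀ a ∈ S, ∀ b ∈ S, a 0 = b 0 → ∀ r : E2, r 0 = a 0 →
  a 1 ≤ r 1 → r 1 ≤ b 1 → r ∈ S

theorem hconv_of (S : Set E2) (h : OrthoConvex S) : HConv S := by
  intro a ha b hb hab r hr h1 h2
  have := (h 0 a).image (fun q : E2 => q 0) (by fun_prop)
  have := this.ordConnected.out (x := a 0) (y := b 0) ⟨a, ⟨ha, by simp⟩, rfl⟩
    ⟨b, ⟨hb, by intro j hj; fin_cases j <;> simp_all⟩, rfl⟩ (show r 0 ∈ _ from ⟨h1, h2⟩)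
  obtain ⟨q, ⟨hq, hq1⟩, hq0⟩ := this
  have : q = r := E2_ext hq0 (by rw [hr]; exact hq1 1 (by simp))
  exact this ▸ hq

theorem vconv_of (S : Set E2) (h : OrthoConvex S) : VConv S := by
  intro a ha b hb hab r hr h1 h2
  have := (h 1 a).image (fun q : E2 => q 1) (by fun_prop)
  have := this.ordConnected.out (x := a 1) (y := b 1) ⟨a, ⟨ha, by intro j hj; fin_cases j <;> simp_all⟩, rfl⟩
    ⟨b, ⟨hb, by intro j hj; fin_cases j <;> simp_all⟩, rfl⟩ (show r 1 ∈ _ from ⟨h1, h2⟩)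
  obtain ⟨q, ⟨hq, hq1⟩, hq0⟩ := this
  have : q = r := E2_ext (by rw [hr]; exact hq1 0 (by simp)) hq0
  exact this ▸ hq

theorem case_C (S : Set E2) (hpc : IsPathConnected S) (hH : HConv S) (p : E2) (ε : ℝ) (hε : 0 < ε)
    (hbox : ∀ q ∈ S, |q 0 - p 0| ≤ ε → |q 1 - p 1| ≤ ε → False)
    (hg : ∀ q ∈ S, min (q 0 - p 0) (q 1 - p 1) < 0)
    (hC : ∀ δ > 0, ∃ q ∈ S, p 0 + ε < q 0 ∧ p 1 - δ ≤ q 1 ∧ q 1 < p 1) :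
    ∃ L : Set E2, StrictlySeparates L S {p} := by
  have hlow : ∀ s ∈ S, s 1 < p 1 := by
    intro s hs
    by_contra hs1
    push Not at hs1
    obtain ⟨q, hq, hq0, hq1, hq2⟩ := hC ε hε
    obtain ⟨γ, hγ⟩ := hpc.joinedIn q hq s hs
    have hcont : Continuous (fun t => min (γ t 0 - p 0) (γ t 1 - p 1)) := by fun_prop
    obtain ⟨t0, -, ht0⟩ := isCompact_univ.exists_isMaxOn Set.univ_nonempty hcont.continuousOn
    have hneg := hg _ (hγ t0)
    set m := min (γ t0 0 - p 0) (γ t0 1 - p 1) with hm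
    have hmax : ∀ t, min (γ t 0 - p 0) (γ t 1 - p 1) ≤ m := fun t => ht0 (Set.mem_univ t)
    have hpos : 0 < min (-m) (min ε (p 1 - q 1)) :=
      lt_min (by linarith) (lt_min hε (by linarith))
    set δ := min (-m) (min ε (p 1 - q 1)) with hδ
    have d1 : δ ≤ -m := min_le_left _ _
    have d2 : δ ≤ ε := (min_le_right _ _).trans (min_le_left _ _)
    have d3 : δ ≤ p 1 - q 1 := (min_le_right _ _).trans (min_le_right _ _)
    obtain ⟨q', hq', hq'0, hq'1, hq'2⟩ := hC (δ/2) (by linarith)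
    have hc1 : Continuous (fun t => γ t 1) := by fun_prop
    have : q' 1 ∈ Set.Icc (γ 0 1) (γ 1 1) := by
      rw [γ.source, γ.target]
      constructor <;> linarith
    obtain ⟨t, ht⟩ := mem_range_of_exists_le_of_exists_ge hc1 ⟨0, this.1⟩ ⟨1, this.2⟩
    have ht : γ t 1 = q' 1 := ht
    have h0 : γ t 0 < p 0 := by
      by_contra h
      push Not at h
      have : m < min (γ t 0 - p 0) (γ t 1 - p 1) := lt_min (by linarith) (by linarith)
      linarith [hmax t]
    have hin := hH _ (hγ t) _ hq' ht !₂[p 0, q' 1] (by simp [ht]) (by simp; linarith) (by simp; linarith)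
    refine hbox _ hin (by simp; linarith) ?_
    simp [abs_le]; constructor <;> linarith
  obtain ⟨q, hq, hq0, hq1, hq2⟩ := hC ε hε
  refine sep_step (p 0 + ε) (p 1) (p 1 - q 1) (by linarith) S p ?_ ?_
  · refine neg_of_conn S hpc.isConnected.isPreconnected
      (fun r => max (r 1 - p 1) (min (r 1 - p 1 + (p 1 - q 1)) (p 0 + ε - r 0))) (by fun_prop) ?_ q hq ?_
    · intro r hr h0
      have h0 : max (r 1 - p 1) (min (r 1 - p 1 + (p 1 - q 1)) (p 0 + ε - r 0)) = 0 := h0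
      have hr1 := hlow r hr
      have hm : min (r 1 - p 1 + (p 1 - q 1)) (p 0 + ε - r 0) = 0 := by
        rcases max_choice (r 1 - p 1) (min (r 1 - p 1 + (p 1 - q 1)) (p 0 + ε - r 0)) with h' | h' <;> linarith
      have m1 := min_le_left (r 1 - p 1 + (p 1 - q 1)) (p 0 + ε - r 0)
      have m2 := min_le_right (r 1 - p 1 + (p 1 - q 1)) (p 0 + ε - r 0)
      rcases min_choice (r 1 - p 1 + (p 1 - q 1)) (p 0 + ε - r 0) with h' | h'
      · have e : r 1 = q 1 := by linarith
        have hin := hH _ hr _ hq e !₂[p 0 + ε, q 1] (by simp [e]) (by simp; linarith) (by simp; linarith)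
        refine hbox _ hin (by simp [abs_of_pos hε]) ?_
        simp [abs_le]; constructor <;> linarith
      · refine hbox _ hr ?_ ?_ <;> rw [abs_le] <;> constructor <;> linarith
    · refine max_lt (by linarith) ?_
      exact lt_of_le_of_lt (min_le_right _ _) (by linarith)
  · exact lt_of_lt_of_le (lt_min (by linarith) (by linarith)) (le_max_right _ _)

/-- symmetries -/
theorem ray_image (e : E2 ≃L[ℝ] E2) (a b : E2) : e '' Ray a b = Ray (e a) (e b) := by
  ext q
  constructor
  · rintro ⟨_, ⟨t, ht, rfl⟩, rfl⟩
    exact ⟨t, ht, by simp⟩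
  · rintro ⟨t, ht, rfl⟩
    exact ⟨_, ⟨t, ht, rfl⟩, by simp⟩

theorem line_image (e : E2 ≃L[ℝ] E2)
    (he : ∀ u v : E2, (u 0 = v 0 ∨ u 1 = v 1) → (e u 0 = e v 0 ∨ e u 1 = e v 1))
    (L : Set E2) (h : IsStaircaseLine L) : IsStaircaseLine (e '' L) := by
  obtain ⟨n, v, hn, h1, h2, ⟨φ, hφ, hi, hr⟩, hL⟩ := h
  refine ⟨n, fun i => e (v i), hn, ?_, ?_, ⟨fun t => e (φ t), by fun_prop, e.injective.comp hi, ?_⟩, ?_⟩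
  · intro i hi1 hi2
    exact ⟨fun h => (h1 i hi1 hi2).1 (e.injective h), he _ _ (h1 i hi1 hi2).2⟩
  · intro i j a b c d f
    obtain ⟨t, ht, h⟩ := h2 i j a b c d f
    refine ⟨t, ht, ?_⟩
    change e (v j) - e (v (j-1)) = t • (e (v i) - e (v (i-1)))
    rw [← map_sub, h, map_smul, map_sub]
  · rw [← hr, ← Set.range_comp]; rfl
  · rw [hL, Set.image_union, Set.image_union, ray_image, ray_image, Set.image_iUnion₂]
    congr 1
    refine Set.iUnion₂_congr fun i _ => ?_
    exact image_segment ℝ e.toLinearEquiv.toLinearMap.toAffineMap (v i) (v (i+1))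

theorem sep_image (e : E2 ≃L[ℝ] E2)
    (he : ∀ u v : E2, (u 0 = v 0 ∨ u 1 = v 1) → (e u 0 = e v 0 ∨ e u 1 = e v 1))
    (L A B : Set E2) (h : StrictlySeparates L A B) :
    StrictlySeparates (e '' L) (e '' A) (e '' B) := by
  obtain ⟨hL, H1, H2, ⟨c1, l1⟩, ⟨c2, l2⟩, f1, f2, hu, hA, hB, dA, dB⟩ := h
  have hf : ∀ H : Set E2, frontier (e '' H) = e '' frontier H :=
    fun H => (e.toHomeomorph.image_frontier H).symm
  refine ⟨line_image e he L hL, e '' H1, e '' H2, ⟨e.toHomeomorph.isClosedMap _ c1, ?_⟩,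
    ⟨e.toHomeomorph.isClosedMap _ c2, ?_⟩, ?_, ?_, ?_, Set.image_mono hA, Set.image_mono hB, ?_, ?_⟩
  · rw [hf]; exact line_image e he _ l1
  · rw [hf]; exact line_image e he _ l2
  · rw [hf, f1]
  · rw [hf, f2]
  · rw [← Set.image_union, hu, Set.image_univ, e.surjective.range_eq]
  · exact (Set.disjoint_image_iff e.injective).2 dA
  · exact (Set.disjoint_image_iff e.injective).2 dB

theorem sep_transfer (e : E2 ≃L[ℝ] E2)
    (he : ∀ u v : E2, (u 0 = v 0 ∨ u 1 = v 1) → (e u 0 = e v 0 ∨ e u 1 = e v 1))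
    (hinv : ∀ u, e (e u) = u) (S : Set E2) (p : E2)
    (h : ∃ L : Set E2, StrictlySeparates L (e '' S) {e p}) :
    ∃ L : Set E2, StrictlySeparates L S {p} := by
  obtain ⟨L, hL⟩ := h
  refine ⟨e '' L, ?_⟩
  · have := sep_image e he _ _ _ hL
    simpa [Set.image_image, hinv] using this

noncomputable def swapL : E2 →ₗ[ℝ] E2 where
  toFun u := !₂[u 1, u 0]
  map_add' u v := by apply E2_ext <;> simp
  map_smul' t v := by apply E2_ext <;> simp

noncomputable def swapE : E2 ≃L[ℝ] E2 :=
  (LinearEquiv.ofInvolutive swapL (fun u => by apply E2_ext <;> simp [swapL])).toContinuousLinearEquiv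

theorem swapE_apply (u : E2) : swapE u = !₂[u 1, u 0] := rfl

noncomputable def diagL (σ τ : ℝ) : E2 →ₗ[ℝ] E2 where
  toFun u := !₂[σ * u 0, τ * u 1]
  map_add' u v := by apply E2_ext <;> simp <;> ring
  map_smul' t v := by apply E2_ext <;> simp <;> ring

noncomputable def diagE (σ τ : ℝ) (hσ : σ * σ = 1) (hτ : τ * τ = 1) : E2 ≃L[ℝ] E2 :=
  (LinearEquiv.ofInvolutive (diagL σ τ) (fun u => by
    apply E2_ext <;> simp [diagL, ← mul_assoc, hσ, hτ])).toContinuousLinearEquiv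

theorem diagE_apply (σ τ : ℝ) (hσ : σ * σ = 1) (hτ : τ * τ = 1) (u : E2) :
    diagE σ τ hσ hτ u = !₂[σ * u 0, τ * u 1] := rfl

theorem main_case (S : Set E2) (hcl : IsClosed S) (hpc : IsPathConnected S)
    (hH : HConv S) (hV : VConv S) (p : E2) (hp : p ∉ S)
    (hR : ∀ q ∈ S, q 1 = p 1 → q 0 < p 0) (hU : ∀ q ∈ S, q 0 = p 0 → q 1 < p 1) :
    ∃ L : Set E2, StrictlySeparates L S {p} := by
  obtain ⟨ε, hε, hbox⟩ := box_exists S hcl p hp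
  by_cases hA : ∃ a ∈ S, min (a 0 - p 0) (a 1 - p 1) < 0
  swap
  · push Not at hA
    refine sep_quadrant (-1) (p 0 + ε) (p 1 + ε) (Or.inr rfl) S p ?_ ?_
    · intro q hq
      have h := hA q hq
      rw [le_min_iff] at h
      rw [min_lt_iff]
      by_contra hc
      push Not at hc
      refine hbox q hq ?_ ?_ <;> rw [abs_le] <;> constructor <;> linarith
    · apply lt_min <;> linarith
  obtain ⟨a, ha, hga⟩ := hA
  have hg : ∀ q ∈ S, min (q 0 - p 0) (q 1 - p 1) < 0 := by
    refine neg_of_conn S hpc.isConnected.isPreconnected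
      (fun q => min (q 0 - p 0) (q 1 - p 1)) (by fun_prop) ?_ a ha hga
    intro q hq h
    have h : min (q 0 - p 0) (q 1 - p 1) = 0 := h
    have m1 := min_le_left (q 0 - p 0) (q 1 - p 1)
    have m2 := min_le_right (q 0 - p 0) (q 1 - p 1)
    rcases min_choice (q 0 - p 0) (q 1 - p 1) with h' | h'
    · linarith [hU q hq (by linarith)]
    · linarith [hR q hq (by linarith)]
  by_cases hB : ∃ δ > 0, ∀ q ∈ S, q 0 < p 0 - δ ∨ q 1 < p 1 - δ
  · obtain ⟨δ, hδ, hB⟩ := hB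
    refine sep_quadrant 1 (p 0 - δ) (p 1 - δ) (Or.inl rfl) S p ?_ ?_
    · intro q hq
      rw [min_lt_iff]
      rcases hB q hq with h | h
      · left; linarith
      · right; linarith
    · apply lt_min <;> linarith
  push Not at hB
  by_cases hC : ∀ δ > 0, ∃ q ∈ S, p 0 + ε < q 0 ∧ p 1 - δ ≤ q 1 ∧ q 1 < p 1
  · exact case_C S hpc hH p ε hε hbox hg hC
  push Not at hC
  obtain ⟨δ1, hδ1, hC⟩ := hC
  refine sep_transfer swapE (fun u v h => by simpa [swapE_apply] using h.symm) (fun u => by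
    apply E2_ext <;> simp [swapE_apply]) S p ?_
  refine case_C (swapE '' S) (hpc.image swapE.continuous) ?_ (swapE p) ε hε ?_ ?_ ?_
  · rintro _ ⟨a, ha, rfl⟩ _ ⟨b, hb, rfl⟩ hab r hr h1 h2
    simp [swapE_apply] at *
    exact ⟨!₂[r 1, r 0], hV a ha b hb hab _ (by simpa using hr) (by simpa using h1) (by simpa using h2),
      by apply E2_ext <;> simp⟩
  · rintro _ ⟨q, hq, rfl⟩ h1 h2
    exact hbox q hq h2 h1
  · rintro _ ⟨q, hq, rfl⟩
    have := hg q hq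
    rw [min_comm] at this
    exact this
  · intro δ hδ
    obtain ⟨q, hq, h0, h1⟩ := hB (min δ (min δ1 ε)) (lt_min hδ (lt_min hδ1 hε))
    have d1 : min δ (min δ1 ε) ≤ δ := min_le_left _ _
    have d2 : min δ (min δ1 ε) ≤ δ1 := (min_le_right _ _).trans (min_le_left _ _)
    have d3 : min δ (min δ1 ε) ≤ ε := (min_le_right _ _).trans (min_le_right _ _)
    refine ⟨swapE q, ⟨q, hq, rfl⟩, ?_⟩
    simp [swapE_apply]
    have hgq := hg q hq
    rw [min_lt_iff] at hgq
    have hCq := hC q hq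
    have key : q 0 ≤ p 0 + ε := by
      by_contra h
      push Not at h
      have := hCq h (by linarith)
      rcases hgq with h | h <;> linarith
    have key2 : p 1 + ε < q 1 := by
      by_contra h
      push Not at h
      refine hbox q hq ?_ ?_ <;> rw [abs_le] <;> constructor <;> linarith
    refine ⟨key2, by linarith, ?_⟩
    rcases hgq with h | h <;> linarith

theorem staircase_separation_point (S : Set (EuclideanSpace ℝ (Fin 2)))
    (hcl : IsClosed S) (hpc : IsPathConnected S) (hoc : OrthoConvex S)
    (p : EuclideanSpace ℝ (Fin 2)) (hp : p ∉ S) :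
    ∃ L : Set (EuclideanSpace ℝ (Fin 2)), StrictlySeparates L S {p} := by
  have hH := hconv_of S hoc
  have hV := vconv_of S hoc
  have hσ : ∃ σ : ℝ, (σ = 1 ∨ σ = -1) ∧ ∀ q ∈ S, q 1 = p 1 → σ * q 0 < σ * p 0 := by
    by_cases h : ∀ q ∈ S, q 1 = p 1 → q 0 < p 0
    · exact ⟨1, Or.inl rfl, by simpa using h⟩
    · refine ⟨-1, Or.inr rfl, ?_⟩
      push Not at h
      obtain ⟨b, hb, hb1, hb0⟩ := h
      intro q hq hq1
      by_contra hc
      exact hp (hH q hq b hb (by rw [hq1, hb1]) p hq1.symm (by linarith) hb0)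
  have hτ : ∃ τ : ℝ, (τ = 1 ∨ τ = -1) ∧ ∀ q ∈ S, q 0 = p 0 → τ * q 1 < τ * p 1 := by
    by_cases h : ∀ q ∈ S, q 0 = p 0 → q 1 < p 1
    · exact ⟨1, Or.inl rfl, by simpa using h⟩
    · refine ⟨-1, Or.inr rfl, ?_⟩
      push Not at h
      obtain ⟨b, hb, hb1, hb0⟩ := h
      intro q hq hq1
      by_contra hc
      exact hp (hV q hq b hb (by rw [hq1, hb1]) p hq1.symm (by linarith) hb0)
  obtain ⟨σ, hσ1, hσ⟩ := hσ
  obtain ⟨τ, hτ1, hτ⟩ := hτ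
  have hσ2 : σ * σ = 1 := by rcases hσ1 with rfl | rfl <;> norm_num
  have hτ2 : τ * τ = 1 := by rcases hτ1 with rfl | rfl <;> norm_num
  have hσ0 : σ ≠ 0 := by rintro rfl; norm_num at hσ2
  have hτ0 : τ ≠ 0 := by rintro rfl; norm_num at hτ2
  set e := diagE σ τ hσ2 hτ2 with he
  have e0 : ∀ u : E2, e u 0 = σ * u 0 := fun u => rfl
  have e1 : ∀ u : E2, e u 1 = τ * u 1 := fun u => rfl
  have hinv : ∀ u : E2, e (e u) = u := fun u => by
    apply E2_ext
    · rw [e0, e0, ← mul_assoc, hσ2, one_mul]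
    · rw [e1, e1, ← mul_assoc, hτ2, one_mul]
  refine sep_transfer e (fun u v h => ?_) hinv S p ?_
  · rw [e0, e0, e1, e1]
    rcases h with h | h
    · left; rw [h]
    · right; rw [h]
  refine main_case (e '' S) (e.toHomeomorph.isClosedMap _ hcl) (hpc.image e.continuous) ?_ ?_ (e p) ?_ ?_ ?_
  · rintro _ ⟨a, ha, rfl⟩ _ ⟨b, hb, rfl⟩ hab r hr h1 h2
    refine ⟨e r, ?_, hinv r⟩
    rw [e1, e1] at hab
    have hab := mul_left_cancel₀ hτ0 hab
    have hr' : e r 1 = a 1 := by rw [e1, hr, e1, ← mul_assoc, hτ2, one_mul]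
    rw [e0] at h1 h2
    rcases hσ1 with h | h
    · exact hH a ha b hb hab _ hr' (by rw [e0, h]; rw [h] at h1 h2; linarith) (by rw [e0, h]; rw [h] at h1 h2; linarith)
    · exact hH b hb a ha hab.symm _ (hr'.trans hab) (by rw [e0, h]; rw [h] at h1 h2; linarith) (by rw [e0, h]; rw [h] at h1 h2; linarith)
  · rintro _ ⟨a, ha, rfl⟩ _ ⟨b, hb, rfl⟩ hab r hr h1 h2
    refine ⟨e r, ?_, hinv r⟩
    rw [e0, e0] at hab
    have hab := mul_left_cancel₀ hσ0 hab
    have hr' : e r 0 = a 0 := by rw [e0, hr, e0, ← mul_assoc, hσ2, one_mul]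
    rw [e1] at h1 h2
    rcases hτ1 with h | h
    · exact hV a ha b hb hab _ hr' (by rw [e1, h]; rw [h] at h1 h2; linarith) (by rw [e1, h]; rw [h] at h1 h2; linarith)
    · exact hV b hb a ha hab.symm _ (hr'.trans hab) (by rw [e1, h]; rw [h] at h1 h2; linarith) (by rw [e1, h]; rw [h] at h1 h2; linarith)
  · rintro ⟨q, hq, h⟩
    exact hp (e.injective h ▸ hq)
  · rintro _ ⟨q, hq, rfl⟩ h
    rw [e1, e1] at h
    exact hσ q hq (mul_left_cancel₀ hτ0 h)
  · rintro _ ⟨q, hq, rfl⟩ h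
    rw [e0, e0] at h
    exact hτ q hq (mul_left_cancel₀ hσ0 h)
end

section
/- The interior of an orthogonally convex set in ℝⁿ is orthogonally convex. -/
theorem OrthoConvex.seg_mem {n : ℕ} {S : Set (EuclideanSpace ℝ (Fin n))}
    (h : OrthoConvex S) (i : Fin n) {p q : EuclideanSpace ℝ (Fin n)} (hp : p ∈ S) (hq : q ∈ S)
    (hpq : ∀ j, j ≠ i → q j = p j) {u v : ℝ} (hu : 0 ≤ u) (hv : 0 ≤ v) (huv : u + v = 1) :
    u • p + v • q ∈ S := by
  have h1 : IsPreconnected ((fun x : EuclideanSpace ℝ (Fin n) => x i) ''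
      {x ∈ S | ∀ j, j ≠ i → x j = p j}) :=
    (h i p).image _ (by fun_prop)
  have h2 := h1.ordConnected.convex (𝕜 := ℝ) ⟨p, ⟨hp, fun _ _ => rfl⟩, rfl⟩ ⟨q, ⟨hq, hpq⟩, rfl⟩ hu hv huv
  obtain ⟨s, ⟨hs, hsl⟩, hsi⟩ := h2
  have : u • p + v • q = s := by
    ext j
    by_cases hj : j = i
    · subst hj
      simpa using hsi.symm
    · simp only [PiLp.add_apply, PiLp.smul_apply, smul_eq_mul, hpq j hj, hsl j hj]
      rw [← add_mul, huv, one_mul]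
  rw [this]; exact hs

/-- The interior of an orthogonally convex set in `ℝⁿ` is orthogonally
convex. -/
theorem orthoConvex_interior {n : ℕ} (S : Set (EuclideanSpace ℝ (Fin n)))
    (h : OrthoConvex S) : OrthoConvex (interior S) := by
  intro i c
  apply Convex.isPreconnected
  rintro a ⟨ha, hac⟩ b ⟨hb, hbc⟩ u v hu hv huv
  refine ⟨?_, fun j hj => ?_⟩
  · rw [mem_interior_iff_mem_nhds] at ha hb ⊢
    have key : ∀ z : EuclideanSpace ℝ (Fin n), Filter.Tendsto (fun y => z + (y - (u • a + v • b)))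
        (nhds (u • a + v • b)) (nhds z) := by
      intro z
      have : Continuous (fun y => z + (y - (u • a + v • b))) := by fun_prop
      simpa using this.tendsto (u • a + v • b)
    filter_upwards [key a ha, key b hb] with y hya hyb
    have := h.seg_mem i hya hyb (fun j hj => by simp [hac j hj, hbc j hj]) hu hv huv
    convert this using 1
    obtain rfl : v = 1 - u := by linarith
    module
  · simp only [PiLp.add_apply, PiLp.smul_apply, smul_eq_mul, hac j hj, hbc j hj]
    rw [← add_mul, huv, one_mul]
end

section
/- The orthogonally convex hull of an open set in ℝⁿ is open. -/
/-- The orthogonally convex hull of `S`: the intersection of all orthogonally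
convex sets containing `S`. -/
def orthoHull {n : ℕ} (S : Set (EuclideanSpace ℝ (Fin n))) : Set (EuclideanSpace ℝ (Fin n)) :=
  ⋂₀ {T | OrthoConvex T ∧ S ⊆ T}

theorem orthoConvex_iff_segment {n : ℕ} (T : Set (EuclideanSpace ℝ (Fin n))) :
    OrthoConvex T ↔ ∀ (i : Fin n) (p q : EuclideanSpace ℝ (Fin n)), p ∈ T → q ∈ T →
      (∀ j, j ≠ i → p j = q j) → segment ℝ p q ⊆ T := by
  constructor
  · intro h i p q hp hq hpq r hr
    have hc := (h i q).image (fun x => x i) (by fun_prop)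
    have ho := hc.ordConnected
    obtain ⟨a, b, ha, hb, hab, rfl⟩ := hr
    have hseg := ho.convex (𝕜 := ℝ) ⟨p, ⟨hp, hpq⟩, rfl⟩ ⟨q, ⟨hq, fun _ _ => rfl⟩, rfl⟩ ha hb hab
    obtain ⟨s, ⟨hs, hsq⟩, hsi⟩ := hseg
    have : s = a • p + b • q := by
      ext j
      by_cases hj : j = i
      · subst hj; simpa using hsi
      · simp only [PiLp.add_apply, PiLp.smul_apply, smul_eq_mul]
        rw [hsq j hj, hpq j hj, ← add_mul, hab, one_mul]
    exact this ▸ hs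
  · intro h i c
    apply Convex.isPreconnected (E := EuclideanSpace ℝ (Fin n))
    rintro p ⟨hp, hpc⟩ q ⟨hq, hqc⟩ a b ha hb hab
    refine ⟨h i p q hp hq (fun j hj => (hpc j hj).trans (hqc j hj).symm)
      ⟨a, b, ha, hb, hab, rfl⟩, fun j hj => ?_⟩
    simp only [PiLp.add_apply, PiLp.smul_apply, smul_eq_mul]
    rw [hpc j hj, hqc j hj, ← add_mul, hab, one_mul]

theorem OrthoConvex.interior_aux {n : ℕ} {T : Set (EuclideanSpace ℝ (Fin n))}
    (h : OrthoConvex T) : OrthoConvex (interior T) := by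
  rw [orthoConvex_iff_segment] at h ⊢
  rintro i p q hp hq hpq r ⟨a, b, ha, hb, hab, rfl⟩
  rw [mem_interior_iff_mem_nhds, Metric.mem_nhds_iff] at hp hq ⊢
  obtain ⟨e, he, hpe⟩ := hp
  obtain ⟨d, hd, hqd⟩ := hq
  refine ⟨min e d, lt_min he hd, fun x hx => ?_⟩
  rw [mem_ball_iff_norm, lt_min_iff] at hx
  set v := x - (a • p + b • q) with hv
  refine h i (p + v) (q + v) (hpe ?_) (hqd ?_) (fun j hj => ?_) ⟨a, b, ha, hb, hab, ?_⟩
  · rw [mem_ball_iff_norm]; simpa using hx.1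
  · rw [mem_ball_iff_norm]; simpa using hx.2
  · simp [hpq j hj]
  · have : a • (p + v) + b • (q + v) = (a • p + b • q) + (a + b) • v := by module
    rw [this, hab, one_smul, hv]; abel

theorem orthoHull_orthoConvex_aux {n : ℕ} (S : Set (EuclideanSpace ℝ (Fin n))) :
    OrthoConvex (orthoHull S) := by
  rw [orthoConvex_iff_segment]
  intro i p q hp hq hpq r hr T hT
  exact (orthoConvex_iff_segment T).1 hT.1 i p q (hp T hT) (hq T hT) hpq hr

/-- The orthogonally convex hull of an open set in `ℝⁿ` is open. -/
theorem orthoHull_isOpen {n : ℕ} (S : Set (EuclideanSpace ℝ (Fin n)))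
    (h : IsOpen S) : IsOpen (orthoHull S) := by
  rw [← subset_interior_iff_isOpen]
  apply Set.sInter_subset_of_mem
  exact ⟨(orthoHull_orthoConvex_aux S).interior_aux,
    interior_maximal (Set.subset_sInter fun T hT => hT.2) h⟩
end

section
/- Let S = {(x,y) ∈ ℝ² : y² = ((x² + 1)/x)², x > 0}. Then S is closed (in ℝ²), and its orthogonally convex hull equals the open half-plane {(x,y) ∈ ℝ² : x > 0}; in particular, the orthogonally convex hull of the closed set S is not closed. -/
lemma OrthoConvex.between {n : ℕ} {T : Set (EuclideanSpace ℝ (Fin n))} (hT : OrthoConvex T)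
    (i : Fin n) {p q r : EuclideanSpace ℝ (Fin n)} (hp : p ∈ T) (hq : q ∈ T)
    (hpr : ∀ j, j ≠ i → p j = r j) (hqr : ∀ j, j ≠ i → q j = r j)
    (h1 : p i ≤ r i) (h2 : r i ≤ q i) : r ∈ T := by
  have h := (hT i r).image (fun s : EuclideanSpace ℝ (Fin n) => s i)
    (by fun_prop : Continuous fun s : EuclideanSpace ℝ (Fin n) => s i).continuousOn
  obtain ⟨s, ⟨hs, hs'⟩, hsi⟩ :=
    h.ordConnected.out ⟨p, ⟨hp, hpr⟩, rfl⟩ ⟨q, ⟨hq, hqr⟩, rfl⟩ ⟨h1, h2⟩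
  have : s = r := by
    ext j
    by_cases hj : j = i
    · subst hj; exact hsi
    · exact hs' j hj
  exact this ▸ hs

lemma halfplane_orthoConvex :
    OrthoConvex {p : EuclideanSpace ℝ (Fin 2) | 0 < p 0} := by
  intro i c
  apply Convex.isPreconnected
  rintro p ⟨hp, hp'⟩ q ⟨hq, hq'⟩ a b ha hb hab
  simp only [Set.mem_ofPred_eq] at hp hq
  refine ⟨?_, fun j hj => ?_⟩
  · simp only [Set.mem_ofPred_eq, PiLp.add_apply, PiLp.smul_apply, smul_eq_mul]
    rcases ha.eq_or_lt with rfl | ha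
    · have : b = 1 := by linarith
      subst this; linarith
    · have := mul_pos ha hp
      have := mul_nonneg hb hq.le
      linarith
  · simp only [PiLp.add_apply, PiLp.smul_apply, smul_eq_mul, hp' j hj, hq' j hj]
    rw [← add_mul, hab, one_mul]

/-- The set `S = {(x,y) : y² = ((x² + 1)/x)², x > 0}` is closed, its
orthogonally convex hull is the open half-plane `{(x,y) : x > 0}`, and in
particular this hull is not closed. -/
theorem orthoHull_of_closed_not_closed
    (S : Set (EuclideanSpace ℝ (Fin 2)))
    (hS : S = {p : EuclideanSpace ℝ (Fin 2) |
      (p 1) ^ 2 = (((p 0) ^ 2 + 1) / p 0) ^ 2 ∧ 0 < p 0}) :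
    IsClosed S ∧
      orthoHull S = {p : EuclideanSpace ℝ (Fin 2) | 0 < p 0} ∧
      ¬ IsClosed (orthoHull S) := by
  have hS' : S = {p : EuclideanSpace ℝ (Fin 2) |
      (p 1 * p 0) ^ 2 = ((p 0) ^ 2 + 1) ^ 2 ∧ 0 ≤ p 0} := by
    rw [hS]
    ext p
    simp only [Set.mem_ofPred_eq]
    constructor
    · rintro ⟨h, h0⟩
      refine ⟨?_, h0.le⟩
      rw [mul_pow, h]
      field_simp
    · rintro ⟨h, h0⟩
      have h0 : 0 < p 0 := by
        rcases h0.eq_or_lt with h1 | h1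
        · rw [← h1] at h; norm_num at h
        · exact h1
      refine ⟨?_, h0⟩
      rw [div_pow, ← h]
      field_simp
  have hmem : ∀ x y : ℝ, 0 < x → (y * x) ^ 2 = (x ^ 2 + 1) ^ 2 → !₂[x, y] ∈ S := by
    intro x y hx h
    rw [hS']
    exact ⟨by simpa using h, by simpa using hx.le⟩
  have hull : orthoHull S = {p : EuclideanSpace ℝ (Fin 2) | 0 < p 0} := by
    apply Set.Subset.antisymm
    · apply Set.sInter_subset_of_mem
      refine ⟨halfplane_orthoConvex, ?_⟩
      rw [hS]
      exact fun p hp => hp.2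
    · rintro p hp T ⟨hT, hST⟩
      have hx : 0 < p 0 := hp
      by_cases hy : |p 1| ≤ (p 0 ^ 2 + 1) / p 0
      · rw [abs_le] at hy
        refine hT.between 1 (hST (hmem (p 0) (-((p 0 ^ 2 + 1) / p 0)) hx ?_))
          (hST (hmem (p 0) ((p 0 ^ 2 + 1) / p 0) hx ?_)) ?_ ?_ ?_ ?_
        · field_simp
        · field_simp
        · intro j hj; fin_cases j <;> simp_all
        · intro j hj; fin_cases j <;> simp_all
        · simpa using hy.1
        · simpa using hy.2
      · rw [not_le, div_lt_iff₀ hx] at hy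
        set z := |p 1| with hz
        have hz0 : 0 ≤ z := abs_nonneg _
        have hzs : p 1 ^ 2 = z ^ 2 := (sq_abs _).symm
        have hz2 : 2 ≤ z := by
          by_contra! hlt
          nlinarith [sq_nonneg (p 0 - 1)]
        have hw : 0 ≤ z ^ 2 - 4 := by nlinarith
        have hw0 := Real.sqrt_nonneg (z ^ 2 - 4)
        have hw1 := Real.sq_sqrt hw
        set w := Real.sqrt (z ^ 2 - 4)
        have hwz : w < z := by nlinarith
        have habs : |2 * p 0 - z| ≤ w := by
          apply abs_le_of_sq_le_sq _ hw0
          nlinarith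
        rw [abs_le] at habs
        refine hT.between 0 (hST (hmem ((z - w) / 2) (p 1) (by linarith) ?_))
          (hST (hmem ((z + w) / 2) (p 1) (by linarith) ?_)) ?_ ?_ ?_ ?_
        · rw [mul_pow, hzs, ← mul_pow]
          congr 1
          linarith
        · rw [mul_pow, hzs, ← mul_pow]
          congr 1
          linarith
        · intro j hj; fin_cases j <;> simp_all
        · intro j hj; fin_cases j <;> simp_all
        · simp; linarith
        · simp; linarith
  refine ⟨?_, hull, ?_⟩
  · rw [hS']
    have c0 : Continuous fun p : EuclideanSpace ℝ (Fin 2) => p 0 := by fun_prop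
    have c1 : Continuous fun p : EuclideanSpace ℝ (Fin 2) => p 1 := by fun_prop
    exact (isClosed_eq ((c1.mul c0).pow 2) (((c0.pow 2).add continuous_const).pow 2)).inter
      (isClosed_le continuous_const c0)
  · rw [hull]
    intro h
    have hc : Continuous (fun t : ℝ => (!₂[t, 0] : EuclideanSpace ℝ (Fin 2))) := by fun_prop
    have h2 := h.preimage hc
    have h3 : (fun t : ℝ => (!₂[t, 0] : EuclideanSpace ℝ (Fin 2))) ⁻¹' {p | 0 < p 0}
        = Set.Ioi 0 := by
      ext t; simp
    rw [h3] at h2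
    have h4 := h2.closure_eq
    rw [closure_Ioi] at h4
    have : (0 : ℝ) ∈ Set.Ioi (0 : ℝ) := h4 ▸ Set.self_mem_Ici
    simp at this
end
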